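/- Let g be a root-reductive Lie algebra with Cartan subalgebra h and arbitrary splitting Borel subalgebra b, and let l_b denote the b-finite root-reductive subalgebra of g, namely the subalgebra generated by h and all simple root spaces. For λ, μ ∈ h*: (i) if λ and μ are not remote (the interval {ν : μ ≤ ν ≤ λ} is finite), then Hom_g(Δ(μ), Δ(λ)) ≅ Hom_{l_b}(Δ_{l_b}(μ), Δ_{l_b}(λ)); (ii) if λ and μ are remote (the interval between them is infinite), then Hom_g(Δ(μ), Δ(λ)) = 0. -/

import Mathlib

set_option linter.unusedSectionVars false

open UniversalEnvelopingAlgebra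

noncomputable section

universe u

variable (K : Type) [Field K] [IsAlgClosed K] [CharZero K]
variable (g : Type) [LieRing g] [LieAlgebra K g]

/-- The weight space of a Lie module for a weight `χ` of a subalgebra `h`. -/
def wtSpace (h : LieSubalgebra K g) (M : Type) [AddCommGroup M] [Module K M]
    [LieRingModule g M] [LieModule K g M] (χ : Module.Dual K h) : Submodule K M where
  carrier := {m | ∀ H : h, ⁅(H : g), m⁆ = χ H • m}
  add_mem' := by intro a b ha hb H; rw [lie_add, ha H, hb H, smul_add]
  zero_mem' := by intro H; rw [lie_zero, smul_zero]
  smul_mem' := by intro c m hm H; rw [lie_smul, hm H, smul_comm]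

/-- The root space of `g` relative to `h` for the functional `α`. -/
abbrev rootSp (h : LieSubalgebra K g) (α : Module.Dual K h) : Submodule K g :=
  wtSpace K g h g α

/-- Notation for the universal enveloping algebra. -/
abbrev UEA (L : Type) [LieRing L] [LieAlgebra K L] : Type :=
  UniversalEnvelopingAlgebra K L

variable {K} in
/-- The Lie module structure on a quotient of the universal enveloping algebra
by a left ideal. -/
instance uqLRM (L : Type) [LieRing L] [LieAlgebra K L]
    (I : Submodule (UEA K L) (UEA K L)) : LieRingModule L ((UEA K L) ⧸ I) where
  bracket x m := ι K x • m
  add_lie x y m := by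
    show (ι K (x + y)) • m = (ι K x) • m + (ι K y) • m
    rw [map_add, add_smul]
  lie_add x m n := by
    show (ι K x) • (m + n) = (ι K x) • m + (ι K x) • n
    rw [smul_add]
  leibniz_lie x y m := by
    show (ι K x) • ((ι K y) • m) = (ι K ⁅x, y⁆) • m + (ι K y) • ((ι K x) • m)
    letI : LieRing (UniversalEnvelopingAlgebra K L) := LieRing.ofAssociativeRing
    rw [LieHom.map_lie, LieRing.of_associative_ring_bracket, sub_smul, mul_smul, mul_smul,
      sub_add_cancel]

variable {K} in
instance uqLM (L : Type) [LieRing L] [LieAlgebra K L]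
    (I : Submodule (UEA K L) (UEA K L)) : LieModule K L ((UEA K L) ⧸ I) where
  smul_lie c x m := by
    show (ι K (c • x)) • m = c • ((ι K x) • m)
    rw [map_smul]
    exact smul_assoc c (ι K x) m
  lie_smul c x m := by
    show (ι K x) • (c • m) = c • ((ι K x) • m)
    exact smul_comm _ _ _

/-- A root-reductive Lie algebra together with a splitting Borel subalgebra `b ⊇ h`
containing a fixed splitting maximal toral (Cartan) subalgebra `h`.  The fields record:
an exhausting chain `gc n` of nested finite-dimensional reductive subalgebras, each
reductive in the next, with compatible Cartan subalgebras and root vectors; the root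
decomposition of `g` with respect to `h` with one-dimensional root spaces; a positive
system `Φp` closed under addition and the corresponding Borel subalgebra `b = h ⊕ n⁺`;
the anti-involution `τ`; coroots and the weight `ρ`. -/
structure RootReductive where
  h : LieSubalgebra K g
  gc : ℕ → LieSubalgebra K g
  gc_mono : Monotone gc
  gc_findim : ∀ n, FiniteDimensional K (gc n)
  gc_exhausts : ∀ x : g, ∃ n, x ∈ gc n
  gc_reductive : ∀ n, LieAlgebra.radical K (gc n) = LieAlgebra.center K (gc n)
  gc_red_in : ∀ n, ∀ N : Submodule K g, N ≤ (gc (n+1)).toSubmodule →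
      (∀ x ∈ gc n, ∀ v ∈ N, ⁅x, v⁆ ∈ N) →
      ∃ N' : Submodule K g, N' ≤ (gc (n+1)).toSubmodule ∧
        (∀ x ∈ gc n, ∀ v ∈ N', ⁅x, v⁆ ∈ N') ∧
        N ⊓ N' = ⊥ ∧ N ⊔ N' = (gc (n+1)).toSubmodule
  gc_cartan : ∀ n, ∃ hc : LieSubalgebra K (gc n),
      ((hc : Set (gc n)) = ((↑) : (gc n) → g) ⁻¹' (h : Set g)) ∧ hc.IsCartanSubalgebra
  h_exhaust : ∀ x ∈ h, ∃ n, x ∈ gc n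
  Φ : Set (Module.Dual K h)
  root_iff : ∀ α, α ∈ Φ ↔ α ≠ 0 ∧ rootSp K g h α ≠ ⊥
  root_dim : ∀ α ∈ Φ, Module.rank K (rootSp K g h α) = 1
  gc_rootdec : ∀ n, (gc n).toSubmodule =
      ((gc n).toSubmodule ⊓ h.toSubmodule) ⊔
        (⨆ α ∈ Φ, ((gc n).toSubmodule ⊓ rootSp K g h α))
  rootdec : h.toSubmodule ⊔ (⨆ α ∈ Φ, rootSp K g h α) = ⊤
  Φp : Set (Module.Dual K h)
  pos_subset : Φp ⊆ Φ
  pos_union : Φ = Φp ∪ (-Φp)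
  pos_disjoint : Disjoint Φp (-Φp)
  pos_add : ∀ α ∈ Φp, ∀ β ∈ Φp, α + β ∈ Φ → α + β ∈ Φp
  b : LieSubalgebra K g
  h_le_b : h ≤ b
  b_def : b.toSubmodule = h.toSubmodule ⊔ (⨆ α ∈ Φp, rootSp K g h α)
  np : LieSubalgebra K g
  np_def : np.toSubmodule = ⨆ α ∈ Φp, rootSp K g h α
  nm : LieSubalgebra K g
  nm_def : nm.toSubmodule = ⨆ α ∈ Φp, rootSp K g h (-α)
  τ : g →ₗ[K] g
  τ_invol : ∀ x, τ (τ x) = x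
  τ_anti : ∀ x y, τ ⁅x, y⁆ = ⁅τ y, τ x⁆
  τ_h : ∀ x ∈ h, τ x = x
  τ_root : ∀ (α : Module.Dual K h), ∀ x ∈ rootSp K g h α, τ x ∈ rootSp K g h (-α)
  coroot : Module.Dual K h → h
  coroot_two : ∀ α ∈ Φ, α (coroot α) = 2
  coroot_neg : ∀ α ∈ Φ, coroot (-α) = - coroot α
  ρ : Module.Dual K h
  ρ_simple : ∀ α ∈ Φp, (¬ ∃ β ∈ Φp, ∃ γ ∈ Φp, β + γ = α) → ρ (coroot α) = 1

namespace RootReductive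

variable {K g} (S : RootReductive K g)

/-- The nilradical `n⁺` of the Borel subalgebra, as a submodule. -/
def nplus : Submodule K g := ⨆ α ∈ S.Φp, rootSp K g S.h α

/-- `Γ⁺`: the additive monoid of sums of positive roots. -/
def Γp : AddSubmonoid (Module.Dual K S.h) := AddSubmonoid.closure S.Φp

/-- The order `μ ≤ λ` iff `λ - μ ∈ Γ⁺`. -/
def wle (μ lam : Module.Dual K S.h) : Prop := lam - μ ∈ S.Γp

/-- The set of simple (positive) roots. -/
def simples : Set (Module.Dual K S.h) :=
  {α ∈ S.Φp | ¬ ∃ β ∈ S.Φp, ∃ γ ∈ S.Φp, β + γ = α}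

/-- `b` is a Dynkin Borel subalgebra: every element of `Γ⁺` is a sum of simple roots. -/
def IsDynkin : Prop := ∀ α ∈ S.Φp, α ∈ AddSubmonoid.closure S.simples

/-- The finite-rank subalgebra `g_n = g̃_n + h`. -/
def gfull (n : ℕ) : LieSubalgebra K g := S.gc n ⊔ S.h

/-- The roots `Φ_n` of `g_n`. -/
def levelRoots (n : ℕ) : Set (Module.Dual K S.h) :=
  {α ∈ S.Φ | rootSp K g S.h α ≤ (S.gfull n).toSubmodule}

/-- The root lattice `ℤΦ_n`. -/
def zrootsLevel (n : ℕ) : AddSubgroup (Module.Dual K S.h) :=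
  AddSubgroup.closure (S.levelRoots n)

/-- The root lattice `ℤΦ`. -/
def zroots : AddSubgroup (Module.Dual K S.h) := AddSubgroup.closure S.Φ

/-- The partial order `≤_n` relative to the positive roots of `g_n`. -/
def wleLevel (n : ℕ) (μ lam : Module.Dual K S.h) : Prop :=
  lam - μ ∈ AddSubmonoid.closure (S.Φp ∩ S.levelRoots n)

/-- The defining left ideal of the Verma module `Δ(λ) = U(g)/I_λ`, where
`I_λ` is generated by `n⁺` and the elements `H - λ(H)`, `H ∈ h`. -/
def vIdeal (lam : Module.Dual K S.h) : Submodule (UEA K g) (UEA K g) :=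
  Submodule.span (UEA K g)
    ({u | ∃ x ∈ S.nplus, u = ι K x} ∪
     {u | ∃ H : S.h, u = ι K (H : g) - algebraMap K (UEA K g) (lam H)})

/-- The Verma module `Δ(λ)`. -/
abbrev Verma (lam : Module.Dual K S.h) : Type := (UEA K g) ⧸ S.vIdeal lam

/-- The left ideal corresponding to the maximal submodule of `Δ(λ)`. -/
def radIdeal (lam : Module.Dual K S.h) : Submodule (UEA K g) (UEA K g) :=
  sSup {J | S.vIdeal lam ≤ J ∧ J ≠ ⊤}

/-- The simple highest weight module `L(λ)`, the unique simple quotient of `Δ(λ)`. -/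
abbrev SimpleHW (lam : Module.Dual K S.h) : Type := (UEA K g) ⧸ S.radIdeal lam

/-- The defining left ideal of the Verma module of a subalgebra `h ≤ a`, relative to the
Borel subalgebra `a ∩ b`. -/
def vIdealSub (a : LieSubalgebra K g) (ha : S.h ≤ a) (lam : Module.Dual K S.h) :
    Submodule (UEA K a) (UEA K a) :=
  Submodule.span (UEA K a)
    ({u | ∃ x : a, (x : g) ∈ S.nplus ∧ u = ι K x} ∪
     {u | ∃ H : S.h, u = ι K (⟨(H : g), ha H.2⟩ : a) - algebraMap K (UEA K a) (lam H)})

/-- The Verma module `Δ_a(λ)` of a subalgebra `h ≤ a ≤ g`. -/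
abbrev VermaSub (a : LieSubalgebra K g) (ha : S.h ≤ a) (lam : Module.Dual K S.h) : Type :=
  (UEA K a) ⧸ S.vIdealSub a ha lam

def radIdealSub (a : LieSubalgebra K g) (ha : S.h ≤ a) (lam : Module.Dual K S.h) :
    Submodule (UEA K a) (UEA K a) :=
  sSup {J | S.vIdealSub a ha lam ≤ J ∧ J ≠ ⊤}

/-- The simple highest weight module `L_a(λ)` of a subalgebra `h ≤ a ≤ g`. -/
abbrev SimpleHWSub (a : LieSubalgebra K g) (ha : S.h ≤ a) (lam : Module.Dual K S.h) : Type :=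
  (UEA K a) ⧸ S.radIdealSub a ha lam

end RootReductive

/-- The subquotient `B/(A ∩ B)` of a module attached to two submodules `A ≤ B`. -/
abbrev subquot {R M : Type} [Ring R] [AddCommGroup M] [Module R M]
    (A B : Submodule R M) : Type :=
  B ⧸ (A.comap B.subtype)

/-- The multiplicity `[M : N]` of a module `N` in a module `M`: the supremum, over all
finite filtrations of `M`, of the number of subquotients isomorphic to `N`. -/
noncomputable def jhMult (R M N : Type) [Ring R] [AddCommGroup M] [Module R M]
    [AddCommGroup N] [Module R N] : Cardinal.{0} :=
  ⨆ (n : ℕ), ⨆ (F : Fin (n+1) →o Submodule R M),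
    ⨆ (_ : F 0 = ⊥ ∧ F (Fin.last n) = ⊤),
      (Nat.card {i : Fin n //
        Nonempty ((subquot (F i.castSucc) (F i.succ)) ≃ₗ[R] N)} : Cardinal)

/-- The `K`-vector space structure on the space of `U(L)`-module homomorphisms,
via the central embedding `K → U(L)`. -/
def homKModule (L : Type) [LieRing L] [LieAlgebra K L] (M N : Type)
    [AddCommGroup M] [Module (UEA K L) M] [AddCommGroup N] [Module (UEA K L) N] :
    Module K (M →ₗ[UEA K L] N) :=
  letI : Module K N := Module.compHom N (algebraMap K (UEA K L))
  letI : SMulCommClass (UEA K L) K N :=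
    ⟨fun u c n => by
      show u • ((algebraMap K (UEA K L) c) • n) = (algebraMap K (UEA K L) c) • (u • n)
      rw [smul_smul, smul_smul, Algebra.commutes]⟩
  inferInstance

/-- The dimension over `K` of the space of `U(L)`-module homomorphisms. -/
noncomputable def homDim (L : Type) [LieRing L] [LieAlgebra K L] (M N : Type)
    [AddCommGroup M] [Module (UEA K L) M] [AddCommGroup N] [Module (UEA K L) N] :
    Cardinal :=
  letI := homKModule K L M N
  Module.rank K (M →ₗ[UEA K L] N)

namespace RootReductive

variable {K g} (S : RootReductive K g)

/-- The weight set of weight `χ` of a `U(g)`-module. -/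
def wtSet (M : Type) [AddCommGroup M] [Module (UEA K g) M]
    (χ : Module.Dual K S.h) : Set M :=
  {m | ∀ H : S.h, (ι K (H : g)) • m = (algebraMap K (UEA K g) (χ H)) • m}

/-- A `U(g)`-module is a weight module (i.e. semisimple as an `h`-module) if it is the
sum of its weight spaces. -/
def IsWeightMod (M : Type) [AddCommGroup M] [Module (UEA K g) M] : Prop :=
  ∀ m : M, m ∈ AddSubgroup.closure (⋃ χ : Module.Dual K S.h, S.wtSet M χ)

/-- The support of a module: the set of weights whose weight space is non-zero. -/
def suppSet (M : Type) [AddCommGroup M] [Module (UEA K g) M] :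
    Set (Module.Dual K S.h) :=
  {χ | ∃ m ∈ S.wtSet M χ, m ≠ 0}

/-- Local finiteness of the action of the Borel subalgebra `b`:
every vector lies in a finite-dimensional `b`-stable subspace. -/
def IsLocFin (M : Type) [AddCommGroup M] [Module (UEA K g) M] : Prop :=
  letI : Module K M := Module.compHom M (algebraMap K (UEA K g))
  ∀ m : M, ∃ N : Submodule K M, m ∈ N ∧ FiniteDimensional K N ∧
    ∀ x ∈ S.b, ∀ v ∈ N, (ι K x) • v ∈ N

/-- The module has finite-dimensional weight spaces. -/
def HasFinDimWt (M : Type) [AddCommGroup M] [Module (UEA K g) M] : Prop :=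
  letI : Module K M := Module.compHom M (algebraMap K (UEA K g))
  ∀ χ : Module.Dual K S.h, ∃ s : Finset M,
    ↑s ⊆ S.wtSet M χ ∧ S.wtSet M χ ⊆ (Submodule.span K (s : Set M) : Set M)

/-- Membership in category `O`: a weight module with locally finite `b`-action. -/
def InO (M : Type) [AddCommGroup M] [Module (UEA K g) M] : Prop :=
  S.IsWeightMod M ∧ S.IsLocFin M

/-- A subset of `h^*` is an ideal for the order `≤`. -/
def IsIdeal (A : Set (Module.Dual K S.h)) : Prop :=
  ∀ lam ∈ A, ∀ μ, S.wle μ lam → μ ∈ A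

/-- A subset of `h^*` is upper finite. -/
def UpperFinite (A : Set (Module.Dual K S.h)) : Prop :=
  ∀ μ ∈ A, {lam ∈ A | S.wle μ lam}.Finite

/-- The dot action of a linear automorphism of `h^*`: `w · λ = w(λ+ρ) - ρ`. -/
def dot (w : Module.Dual K S.h ≃ₗ[K] Module.Dual K S.h)
    (lam : Module.Dual K S.h) : Module.Dual K S.h :=
  w (lam + S.ρ) - S.ρ

/-- The dot action of the reflection `r_α`: `r_α · λ = λ - (λ+ρ)(Hα) α`. -/
def rdot (α lam : Module.Dual K S.h) : Module.Dual K S.h :=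
  lam - ((lam + S.ρ) (S.coroot α)) • α

/-- One step of the Bruhat order: `μ = r_α · λ ≤ λ` for a positive root `α`. -/
def bruhatStep (μ lam : Module.Dual K S.h) : Prop :=
  ∃ α ∈ S.Φp, μ = S.rdot α lam ∧ S.wle μ lam

/-- The Bruhat order on `h^*`. -/
def bruhat : Module.Dual K S.h → Module.Dual K S.h → Prop :=
  Relation.ReflTransGen (fun μ lam => S.bruhatStep μ lam)

/-- The set of reflections `r_α`, `α ∈ Φ`, as linear automorphisms of `h^*`. -/
def reflSet : Set (Module.Dual K S.h ≃ₗ[K] Module.Dual K S.h) :=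
  {w | ∃ α ∈ S.Φ, ∀ lam, w lam = lam - (lam (S.coroot α)) • α}

/-- The Weyl group `W`, generated by all reflections. -/
def weylGroup : Subgroup (Module.Dual K S.h ≃ₗ[K] Module.Dual K S.h) :=
  Subgroup.closure S.reflSet

/-- The integral Weyl group `W[λ]` of a weight. -/
def intWeyl (lam : Module.Dual K S.h) :
    Set (Module.Dual K S.h ≃ₗ[K] Module.Dual K S.h) :=
  {w | w ∈ S.weylGroup ∧ S.dot w lam - lam ∈ S.zroots}

/-- The orbit `[[λ]] = W[λ] · λ`. -/
def orbit (lam : Module.Dual K S.h) : Set (Module.Dual K S.h) :=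
  {μ | ∃ w ∈ S.intWeyl lam, μ = S.dot w lam}

/-- An integral weight. -/
def IsIntegral (lam : Module.Dual K S.h) : Prop :=
  ∀ w ∈ S.weylGroup, S.dot w lam - lam ∈ S.zroots

/-- A dominant weight. -/
def IsDominant (lam : Module.Dual K S.h) : Prop :=
  ∀ w ∈ S.intWeyl lam, S.wle (S.dot w lam) lam

/-- An antidominant weight. -/
def IsAntidominant (lam : Module.Dual K S.h) : Prop :=
  ∀ w ∈ S.intWeyl lam, S.wle lam (S.dot w lam)

/-- A regular weight. -/
def IsRegular (lam : Module.Dual K S.h) : Prop :=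
  ∀ w ∈ S.intWeyl lam, S.dot w lam = lam → w = 1

/-- A Verma flag with highest weights in a prescribed set. -/
def HasVermaFlagIn (A : Set (Module.Dual K S.h)) (M : Type) [AddCommGroup M]
    [Module (UEA K g) M] : Prop :=
  ∃ (n : ℕ) (F : Fin (n+1) →o Submodule (UEA K g) M), F 0 = ⊥ ∧ F (Fin.last n) = ⊤ ∧
    ∀ i : Fin n, ∃ lam ∈ A,
      Nonempty ((subquot (F i.castSucc) (F i.succ)) ≃ₗ[UEA K g] S.Verma lam)

/-- A (finite) Verma flag. -/
def HasVermaFlag (M : Type) [AddCommGroup M] [Module (UEA K g) M] : Prop :=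
  S.HasVermaFlagIn Set.univ M

end RootReductive
variable {K} {g}

/-- The `b`-finite root-reductive subalgebra `l_b` of `g`: the subalgebra generated by
`h` and all simple root spaces (positive and negative). -/
def bFinitePart (S : RootReductive K g) : LieSubalgebra K g :=
  LieSubalgebra.lieSpan K g
    ((S.h : Set g) ∪
      ⋃ α ∈ S.simples, ((rootSp K g S.h α : Set g) ∪ (rootSp K g S.h (-α) : Set g)))

lemma h_le_bFinitePart (S : RootReductive K g) : S.h ≤ bFinitePart S :=
  fun _ hx => LieSubalgebra.subset_lieSpan (Set.mem_union_left _ hx)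

/-- Two weights are remote if the interval between them is infinite. -/
def RootReductive.Remote (S : RootReductive K g) (μ lam : Module.Dual K S.h) : Prop :=
  {ν | S.wle μ ν ∧ S.wle ν lam}.Infinite

section

open MvPolynomial

/-- A complement `span f` of a subalgebra `ker π`, together with a character `χ` of `ker π`
extended by zero to the complement. -/
structure InductionDatum (𝕜 L I : Type*) [Field 𝕜] [LieRing L] [LieAlgebra 𝕜 L] where
  f : I → L
  π : L →ₗ[𝕜] (I →₀ 𝕜)
  χ : L →ₗ[𝕜] 𝕜
  π_f : ∀ i, π (f i) = Finsupp.single i 1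
  χ_f : ∀ i, χ (f i) = 0
  π_lie : ∀ x y, π x = 0 → π y = 0 → π ⁅x, y⁆ = 0
  χ_lie : ∀ x y, π x = 0 → π y = 0 → χ ⁅x, y⁆ = 0

namespace InductionDatum

variable {𝕜 L I : Type*} [Field 𝕜] [LieRing L] [LieAlgebra 𝕜 L]

/-- Polynomials of degree less than `d`. -/
noncomputable def degLT (𝕜 I : Type*) [Field 𝕜] (d : ℕ) : Submodule 𝕜 (MvPolynomial I 𝕜) :=
  Submodule.span 𝕜 {p | ∃ m : I →₀ ℕ, m.degree < d ∧ p = monomial m 1}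

lemma monomial_mem_degLT {m : I →₀ ℕ} {d : ℕ} (h : m.degree < d) :
    monomial m (1 : 𝕜) ∈ degLT 𝕜 I d := Submodule.subset_span ⟨m, h, rfl⟩

lemma degLT_mono {d e : ℕ} (h : d ≤ e) : degLT 𝕜 I d ≤ degLT 𝕜 I e :=
  Submodule.span_mono fun _ ⟨m, hm, hp⟩ => ⟨m, hm.trans_le h, hp⟩

lemma map_degLT_le {W : Type*} [AddCommGroup W] [Module 𝕜 W] (T : MvPolynomial I 𝕜 →ₗ[𝕜] W)
    (N : Submodule 𝕜 W) (d : ℕ) (h : ∀ m : I →₀ ℕ, m.degree < d → T (monomial m 1) ∈ N)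
    {p : MvPolynomial I 𝕜} (hp : p ∈ degLT 𝕜 I d) : T p ∈ N := by
  have : degLT 𝕜 I d ≤ N.comap T := by
    rw [degLT, Submodule.span_le]
    rintro _ ⟨m, hm, rfl⟩
    exact h m hm
  exact this hp

lemma eq_on_degLT {W : Type*} [AddCommGroup W] [Module 𝕜 W] (S T : MvPolynomial I 𝕜 →ₗ[𝕜] W)
    (d : ℕ) (h : ∀ m : I →₀ ℕ, m.degree < d → S (monomial m 1) = T (monomial m 1))
    {p : MvPolynomial I 𝕜} (hp : p ∈ degLT 𝕜 I d) : S p = T p := by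
  have := map_degLT_le (S - T) ⊥ d (fun m hm => by simp [h m hm]) hp
  simpa [sub_eq_zero] using this

lemma X_mul_mem_degLT (i : I) {d : ℕ} {p : MvPolynomial I 𝕜} (hp : p ∈ degLT 𝕜 I d) :
    X i * p ∈ degLT 𝕜 I (d + 1) := by
  refine map_degLT_le (LinearMap.mulLeft 𝕜 (X i)) _ d (fun m hm => ?_) hp
  rw [LinearMap.mulLeft_apply, X, monomial_mul, one_mul]
  exact monomial_mem_degLT (by rw [map_add, Finsupp.degree_single]; omega)

lemma X_mul_monomial (i : I) (m : I →₀ ℕ) :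
    (X i : MvPolynomial I 𝕜) * monomial m 1 = monomial (Finsupp.single i 1 + m) 1 := by
  rw [X, monomial_mul, one_mul]

lemma constr_monomial {W : Type*} [AddCommGroup W] [Module 𝕜 W] (F : (I →₀ ℕ) → W)
    (m : I →₀ ℕ) : (basisMonomials I 𝕜).constr 𝕜 F (monomial m 1) = F m := by
  have := (basisMonomials I 𝕜).constr_basis 𝕜 F m
  rwa [coe_basisMonomials] at this

variable (D : InductionDatum 𝕜 L I)

/-- The linear polynomial attached to an element. -/
noncomputable def lin : L →ₗ[𝕜] MvPolynomial I 𝕜 :=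
  Finsupp.linearCombination 𝕜 (X : I → MvPolynomial I 𝕜) ∘ₗ D.π

@[simp] lemma lin_f (i : I) : D.lin (D.f i) = X i := by
  simp [lin, D.π_f]

lemma lin_mul_mem {d : ℕ} {p : MvPolynomial I 𝕜} (x : L) (hp : p ∈ degLT 𝕜 I d) :
    D.lin x * p ∈ degLT 𝕜 I (d + 1) := by
  rw [lin, LinearMap.comp_apply, Finsupp.linearCombination_apply, Finsupp.sum, Finset.sum_mul]
  refine Submodule.sum_mem _ fun i _ => ?_
  rw [smul_mul_assoc]
  exact Submodule.smul_mem _ _ (X_mul_mem_degLT i hp)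

lemma lin_eq_zero {x : L} (hx : D.π x = 0) : D.lin x = 0 := by
  simp [lin, hx]

/-- Every element is a combination of the `f i` and an element of `ker π`. -/
lemma sub_mem_ker (x : L) : D.π (x - Finsupp.linearCombination 𝕜 D.f (D.π x)) = 0 := by
  have : ∀ c, D.π (Finsupp.linearCombination 𝕜 D.f c) = c := by
    intro c
    induction c using Finsupp.induction_linear with
    | zero => simp
    | add a b ha hb => simp [ha, hb]
    | single i a => simp [D.π_f]
  rw [map_sub, this, sub_self]

lemma induction_ker (N : Submodule 𝕜 L) (h₁ : ∀ i, D.f i ∈ N) (h₂ : ∀ x, D.π x = 0 → x ∈ N)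
    (x : L) : x ∈ N := by
  rw [← sub_add_cancel x (Finsupp.linearCombination 𝕜 D.f (D.π x))]
  refine N.add_mem (h₂ _ (D.sub_mem_ker x)) ?_
  rw [Finsupp.linearCombination_apply]
  exact N.sum_mem fun i _ => N.smul_mem _ (h₁ i)

variable [LinearOrder I]

/-- Remove the components of `x` along the `f i` with `i ≤ y`. -/
noncomputable def cut (y : I) : L →ₗ[𝕜] L :=
  LinearMap.id - Finsupp.linearCombination 𝕜 (fun i => if i ≤ y then D.f i else 0) ∘ₗ D.π

lemma cut_f_of_le {i y : I} (h : i ≤ y) : D.cut y (D.f i) = 0 := by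
  simp [cut, D.π_f, h]

lemma cut_cut (y : I) (x : L) : D.cut y (D.cut y x) = D.cut y x := by
  have : ∀ c, D.cut y (Finsupp.linearCombination 𝕜 (fun i => if i ≤ y then D.f i else 0) c)
      = 0 := by
    intro c
    induction c using Finsupp.induction_linear with
    | zero => simp
    | add a b ha hb => simp [ha, hb]
    | single i a =>
      rw [Finsupp.linearCombination_single]
      split_ifs with h
      · rw [map_smul, D.cut_f_of_le h, smul_zero]
      · simp
  conv_lhs => rw [show D.cut y x = x - Finsupp.linearCombination 𝕜
    (fun i => if i ≤ y then D.f i else 0) (D.π x) from rfl, map_sub, this, sub_zero]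

lemma induction_cut (y : I) (N : Submodule 𝕜 L) (h₁ : ∀ i ≤ y, D.f i ∈ N)
    (h₂ : ∀ x, D.cut y x = x → x ∈ N) (x : L) : x ∈ N := by
  have e : x = D.cut y x +
      Finsupp.linearCombination 𝕜 (fun i => if i ≤ y then D.f i else 0) (D.π x) := by
    simp [cut]
  rw [e]
  refine N.add_mem (h₂ _ (D.cut_cut y x)) ?_
  rw [Finsupp.linearCombination_apply]
  refine N.sum_mem fun i _ => N.smul_mem _ ?_
  split_ifs with h
  · exact h₁ i h
  · exact N.zero_mem

lemma lin_of_cut {y : I} {x : L} (hx : D.cut y x = x) (N : Submodule 𝕜 (MvPolynomial I 𝕜))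
    (h : ∀ i, y < i → X i ∈ N) : D.lin x ∈ N := by
  have key : ∀ c, Finsupp.linearCombination 𝕜 (X : I → MvPolynomial I 𝕜) c - D.lin
      (Finsupp.linearCombination 𝕜 (fun i => if i ≤ y then D.f i else 0) c) ∈ N := by
    intro c
    induction c using Finsupp.induction_linear with
    | zero => simp
    | add a b ha hb =>
      rw [map_add, map_add, map_add, add_sub_add_comm]
      exact N.add_mem ha hb
    | single i a =>
      rw [Finsupp.linearCombination_single, Finsupp.linearCombination_single, map_smul,
        ← smul_sub]
      refine N.smul_mem _ ?_
      split_ifs with hi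
      · simp
      · simpa using h i (not_le.mp hi)
  have := key (D.π x)
  rw [← hx, cut, LinearMap.sub_apply, map_sub]
  exact this

/-- The smallest variable of a nontrivial monomial. -/
noncomputable def minVar (m : I →₀ ℕ) (h : m ≠ 0) : I := m.support.min' (Finsupp.support_nonempty_iff.mpr h)

lemma minVar_mem {m : I →₀ ℕ} (h : m ≠ 0) : minVar m h ∈ m.support :=
  Finset.min'_mem _ _

lemma minVar_le {m : I →₀ ℕ} (h : m ≠ 0) : ∀ j ∈ m.support, minVar m h ≤ j :=
  fun j hj => Finset.min'_le _ j hj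

/-- Remove one occurrence of the smallest variable. -/
noncomputable def tail (m : I →₀ ℕ) (h : m ≠ 0) : I →₀ ℕ := m - Finsupp.single (minVar m h) 1

lemma single_add_tail {m : I →₀ ℕ} (h : m ≠ 0) :
    Finsupp.single (minVar m h) 1 + tail m h = m := by
  refine add_tsub_cancel_of_le (Finsupp.single_le_iff.mpr ?_)
  exact Nat.one_le_iff_ne_zero.mpr (Finsupp.mem_support_iff.mp (Finset.min'_mem _ _))

lemma minVar_le_tail {m : I →₀ ℕ} (h : m ≠ 0) : ∀ j ∈ (tail m h).support, minVar m h ≤ j :=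
  fun j hj => minVar_le h j (Finsupp.support_tsub hj)

lemma degree_tail {m : I →₀ ℕ} (h : m ≠ 0) : (tail m h).degree + 1 = m.degree := by
  conv_rhs => rw [← single_add_tail h, map_add, Finsupp.degree_single, add_comm]

lemma minVar_single_add {i : I} {m : I →₀ ℕ} (hi : ∀ j ∈ m.support, i ≤ j)
    (h : Finsupp.single i 1 + m ≠ 0) : minVar (Finsupp.single i 1 + m) h = i := by
  refine le_antisymm (minVar_le h i (by simp)) ?_
  have hm := Finset.min'_mem _ (Finsupp.support_nonempty_iff.mpr h)
  rcases Finset.mem_union.mp (Finsupp.support_add hm) with h' | h'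
  · exact (Finset.mem_singleton.mp (Finsupp.support_single_subset h')).ge
  · exact hi _ h'

lemma tail_single_add {i : I} {m : I →₀ ℕ} (hi : ∀ j ∈ m.support, i ≤ j)
    (h : Finsupp.single i 1 + m ≠ 0) : tail (Finsupp.single i 1 + m) h = m := by
  rw [tail, minVar_single_add hi h, add_tsub_cancel_left]

/-- Approximations of the action, correct on polynomials of degree at most the first argument. -/
noncomputable def approx : ℕ → (MvPolynomial I 𝕜 →ₗ[𝕜] L →ₗ[𝕜] MvPolynomial I 𝕜)
  | 0 => (basisMonomials I 𝕜).constr 𝕜 fun m =>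
      LinearMap.mulRight 𝕜 (monomial m 1) ∘ₗ D.lin + LinearMap.toSpanSingleton 𝕜 _ 1 ∘ₗ D.χ
  | d + 1 => (basisMonomials I 𝕜).constr 𝕜 fun m =>
      LinearMap.mulRight 𝕜 (monomial m 1) ∘ₗ D.lin +
        if h : m = 0 then LinearMap.toSpanSingleton 𝕜 _ 1 ∘ₗ D.χ else
          ((approx d).flip (D.f (minVar m h)) ∘ₗ
              (approx d (monomial (tail m h) 1) -
                LinearMap.mulRight 𝕜 (monomial (tail m h) 1) ∘ₗ D.lin) +
            approx d (monomial (tail m h) 1) ∘ₗ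
              (-(LieAlgebra.ad 𝕜 L (D.f (minVar m h)) : L →ₗ[𝕜] L))) ∘ₗ D.cut (minVar m h)

lemma approx_zero (m : I →₀ ℕ) (x : L) :
    D.approx 0 (monomial m 1) x = D.lin x * monomial m 1 + D.χ x • 1 := by
  conv_lhs => rw [approx, constr_monomial]
  simp

lemma approx_succ_zero (d : ℕ) (x : L) :
    D.approx (d + 1) (monomial 0 1) x = D.lin x * monomial 0 1 + D.χ x • 1 := by
  conv_lhs => rw [approx, constr_monomial]
  simp

lemma approx_succ (d : ℕ) (m : I →₀ ℕ) (h : m ≠ 0) (x : L) :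
    D.approx (d + 1) (monomial m 1) x = D.lin x * monomial m 1 +
      (D.approx d (D.approx d (monomial (tail m h) 1) (D.cut (minVar m h) x) -
          D.lin (D.cut (minVar m h) x) * monomial (tail m h) 1) (D.f (minVar m h)) +
        D.approx d (monomial (tail m h) 1) ⁅D.cut (minVar m h) x, D.f (minVar m h)⁆) := by
  conv_lhs => rw [approx, constr_monomial]
  rw [dif_neg h]
  simp only [LinearMap.add_apply, LinearMap.comp_apply, LinearMap.flip_apply, LinearMap.sub_apply,
    LinearMap.mulRight_apply, LinearMap.neg_apply, LieAlgebra.ad_apply,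
    lie_skew]

lemma approx_sub_mem (d : ℕ) : ∀ (e : ℕ) (p : MvPolynomial I 𝕜), p ∈ degLT 𝕜 I e → ∀ x : L,
    D.approx d p x - D.lin x * p ∈ degLT 𝕜 I e := by
  suffices H : ∀ (m : I →₀ ℕ) (x : L), D.approx d (monomial m 1) x - D.lin x * monomial m 1 ∈
      degLT 𝕜 I (m.degree + 1) by
    intro e p hp x
    refine map_degLT_le ((D.approx d).flip x - LinearMap.mulLeft 𝕜 (D.lin x)) _ e
      (fun m hm => degLT_mono hm (H m x)) hp
  have one_mem : (1 : MvPolynomial I 𝕜) ∈ degLT 𝕜 I 1 :=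
    monomial_mem_degLT (m := 0) (by simp)
  induction d with
  | zero =>
    intro m x
    rw [approx_zero, add_sub_cancel_left]
    exact Submodule.smul_mem _ _ (degLT_mono (by omega) one_mem)
  | succ d ih =>
    have ih' : ∀ (e : ℕ) (p : MvPolynomial I 𝕜), p ∈ degLT 𝕜 I e → ∀ x : L,
        D.approx d p x ∈ degLT 𝕜 I (e + 1) := by
      intro e p hp x
      rw [← sub_add_cancel (D.approx d p x) (D.lin x * p)]
      refine add_mem (degLT_mono (Nat.le_succ e) ?_) (D.lin_mul_mem x hp)
      exact map_degLT_le ((D.approx d).flip x - LinearMap.mulLeft 𝕜 (D.lin x)) _ e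
        (fun m hm => degLT_mono hm (ih m x)) hp
    intro m x
    by_cases h : m = 0
    · subst h
      rw [approx_succ_zero, add_sub_cancel_left]
      exact Submodule.smul_mem _ _ (degLT_mono (by omega) one_mem)
    · rw [approx_succ _ _ _ h, add_sub_cancel_left, ← degree_tail h]
      exact add_mem (ih' _ _ (ih _ _) _)
        (ih' _ _ (monomial_mem_degLT (Nat.lt_succ_self _)) _)

lemma approx_succ_eq (d : ℕ) : ∀ (p : MvPolynomial I 𝕜), p ∈ degLT 𝕜 I (d + 1) → ∀ x : L,
    D.approx (d + 1) p x = D.approx d p x := by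
  suffices H : ∀ (m : I →₀ ℕ), m.degree ≤ d → ∀ x : L,
      D.approx (d + 1) (monomial m 1) x = D.approx d (monomial m 1) x by
    intro p hp x
    exact eq_on_degLT ((D.approx (d + 1)).flip x) ((D.approx d).flip x) (d + 1)
      (fun m hm => H m (Nat.lt_succ_iff.mp hm) x) hp
  induction d with
  | zero =>
    intro m hm x
    obtain rfl : m = 0 := (Finsupp.degree_eq_zero_iff m).mp (by omega)
    rw [approx_succ_zero, approx_zero]
  | succ d ih =>
    intro m hm x
    by_cases h : m = 0
    · subst h
      rw [approx_succ_zero, approx_succ_zero]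
    · have ht := degree_tail h
      have hmem : monomial (tail m h) (1 : 𝕜) ∈ degLT 𝕜 I (d + 1) :=
        monomial_mem_degLT (by omega)
      rw [approx_succ _ _ _ h, approx_succ _ _ _ h, ih _ (by omega), ih _ (by omega)]
      congr 2
      exact eq_on_degLT ((D.approx (d + 1)).flip _) ((D.approx d).flip _) (d + 1)
        (fun m hm => ih m (Nat.lt_succ_iff.mp hm) _) (D.approx_sub_mem d _ _ hmem _)

/-- The action on the polynomial ring. -/
noncomputable def act : L →ₗ[𝕜] MvPolynomial I 𝕜 →ₗ[𝕜] MvPolynomial I 𝕜 :=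
  ((basisMonomials I 𝕜).constr 𝕜 fun m => D.approx m.degree (monomial m 1)).flip

lemma act_monomial_eq_approx (m : I →₀ ℕ) (x : L) {d : ℕ} (h : m.degree ≤ d) :
    D.act x (monomial m 1) = D.approx d (monomial m 1) x := by
  have : D.act x (monomial m 1) = D.approx m.degree (monomial m 1) x := by
    conv_lhs => rw [act, LinearMap.flip_apply, constr_monomial]
  rw [this]
  induction d, h using Nat.le_induction with
  | base => rfl
  | succ d hd ih => rw [ih, D.approx_succ_eq d _ (monomial_mem_degLT (by omega))]

lemma act_eq_approx {p : MvPolynomial I 𝕜} {d : ℕ} (h : p ∈ degLT 𝕜 I (d + 1)) (x : L) :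
    D.act x p = D.approx d p x :=
  eq_on_degLT (D.act x) ((D.approx d).flip x) (d + 1)
    (fun m hm => D.act_monomial_eq_approx m x (Nat.lt_succ_iff.mp hm)) h

lemma act_sub_mem {p : MvPolynomial I 𝕜} {d : ℕ} (h : p ∈ degLT 𝕜 I d) (x : L) :
    D.act x p - D.lin x * p ∈ degLT 𝕜 I d := by
  rw [D.act_eq_approx (degLT_mono (Nat.le_succ d) h)]
  exact D.approx_sub_mem d d p h x

lemma act_one (x : L) : D.act x 1 = D.lin x + D.χ x • 1 := by
  have := D.act_monomial_eq_approx 0 x (d := 0) (by simp)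
  rw [approx_zero] at this
  simpa using this

lemma act_monomial {m : I →₀ ℕ} (h : m ≠ 0) (x : L) :
    D.act x (monomial m 1) = D.lin x * monomial m 1 +
      (D.act (D.f (minVar m h)) (D.act (D.cut (minVar m h) x) (monomial (tail m h) 1) -
          D.lin (D.cut (minVar m h) x) * monomial (tail m h) 1) +
        D.act ⁅D.cut (minVar m h) x, D.f (minVar m h)⁆ (monomial (tail m h) 1)) := by
  have ht := degree_tail h
  have hm : monomial (tail m h) (1 : 𝕜) ∈ degLT 𝕜 I ((tail m h).degree + 1) :=
    monomial_mem_degLT (Nat.lt_succ_self _)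
  rw [D.act_monomial_eq_approx m x ht.ge, D.approx_succ _ _ h,
    D.act_monomial_eq_approx (tail m h) _ le_rfl, D.act_monomial_eq_approx (tail m h) _ le_rfl,
    D.act_eq_approx (D.approx_sub_mem _ _ _ hm _)]

lemma act_f_monomial {i : I} {m : I →₀ ℕ} (hi : ∀ j ∈ m.support, i ≤ j) :
    D.act (D.f i) (monomial m 1) = X i * monomial m 1 := by
  by_cases h : m = 0
  · subst h
    have := D.act_one (D.f i)
    rw [D.χ_f, lin_f, zero_smul, add_zero] at this
    simpa using this
  · rw [D.act_monomial h, D.cut_f_of_le (hi _ (minVar_mem h))]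
    simp

/-- The commutation relation with the smallest variable, for `x` without components along
smaller variables. -/
lemma act_X_mul_of_cut {y : I} {m : I →₀ ℕ} (hy : ∀ j ∈ m.support, y ≤ j) {x : L}
    (hx : D.cut y x = x) :
    D.act x (X y * monomial m 1) =
      D.act (D.f y) (D.act x (monomial m 1)) + D.act ⁅x, D.f y⁆ (monomial m 1) := by
  have h : Finsupp.single y 1 + m ≠ 0 := by
    intro h
    have := DFunLike.congr_fun h y
    simp at this
  have hl : D.act (D.f y) (D.lin x * monomial m 1) = X y * (D.lin x * monomial m 1) := by
    have := D.lin_of_cut hx (LinearMap.ker ((D.act (D.f y) - LinearMap.mulLeft 𝕜 (X y)) ∘ₗ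
      LinearMap.mulRight 𝕜 (monomial m 1))) (fun i hi => by
        rw [LinearMap.mem_ker, LinearMap.comp_apply, LinearMap.mulRight_apply,
          LinearMap.sub_apply, LinearMap.mulLeft_apply, X_mul_monomial, sub_eq_zero]
        refine D.act_f_monomial fun j hj => ?_
        rcases Finset.mem_union.mp (Finsupp.support_add hj) with h' | h'
        · exact (Finset.mem_singleton.mp (Finsupp.support_single_subset h')) ▸ hi.le
        · exact hy j h')
    simpa [sub_eq_zero] using this
  rw [X_mul_monomial, D.act_monomial h, minVar_single_add hy h, tail_single_add hy h, hx, map_sub,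
    hl, ← X_mul_monomial]
  ring

lemma act_X_mul {y : I} {m : I →₀ ℕ} (hy : ∀ j ∈ m.support, y ≤ j) (x : L) :
    D.act x (X y * monomial m 1) =
      D.act (D.f y) (D.act x (monomial m 1)) + D.act ⁅x, D.f y⁆ (monomial m 1) := by
  let T : L →ₗ[𝕜] MvPolynomial I 𝕜 := D.act.flip (X y * monomial m 1) -
    (D.act (D.f y) ∘ₗ D.act.flip (monomial m 1) + D.act.flip (monomial m 1) ∘ₗ
      (-(LieAlgebra.ad 𝕜 L (D.f y) : L →ₗ[𝕜] L)))
  have hT : ∀ x, T x = D.act x (X y * monomial m 1) -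
      (D.act (D.f y) (D.act x (monomial m 1)) + D.act ⁅x, D.f y⁆ (monomial m 1)) := fun x => by
    simp only [T, LinearMap.add_apply, LinearMap.comp_apply, LinearMap.flip_apply,
      LinearMap.sub_apply, LinearMap.neg_apply, LieAlgebra.ad_apply,
      lie_skew]
  rw [← sub_eq_zero, ← hT]
  refine D.induction_cut y (LinearMap.ker T) (fun i hi => ?_) (fun x hx => ?_) x
  · rw [LinearMap.mem_ker, hT, sub_eq_zero]
    have hi' : ∀ j ∈ m.support, i ≤ j := fun j hj => hi.trans (hy j hj)
    rw [D.act_f_monomial hi', X_mul_monomial, D.act_f_monomial, ← X_mul_monomial]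
    swap
    · intro j hj
      rcases Finset.mem_union.mp (Finsupp.support_add hj) with h' | h'
      · exact (Finset.mem_singleton.mp (Finsupp.support_single_subset h')) ▸ hi
      · exact hi' j h'
    rcases hi.eq_or_lt with rfl | hlt
    · rw [lie_self, map_zero, LinearMap.zero_apply, add_zero, X_mul_monomial, D.act_f_monomial]
      intro j hj
      rcases Finset.mem_union.mp (Finsupp.support_add hj) with h' | h'
      · exact (Finset.mem_singleton.mp (Finsupp.support_single_subset h')) ▸ le_rfl
      · exact hi' j h'
    · rw [D.act_X_mul_of_cut hi' (by simp [cut, D.π_f, hlt]), D.act_f_monomial hy, X_mul_monomial y,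
        D.act_f_monomial, ← lie_skew, map_neg, LinearMap.neg_apply, neg_add_cancel_right,
        ← X_mul_monomial]
      intro j hj
      rcases Finset.mem_union.mp (Finsupp.support_add hj) with h' | h'
      · exact (Finset.mem_singleton.mp (Finsupp.support_single_subset h')) ▸ hi
      · exact hi' j h'
  · rw [LinearMap.mem_ker, hT, sub_eq_zero]
    exact D.act_X_mul_of_cut hy hx

/-- The failure of `act` to respect the bracket. -/
noncomputable def defect (p : MvPolynomial I 𝕜) : L →ₗ[𝕜] L →ₗ[𝕜] MvPolynomial I 𝕜 :=
  LinearMap.mk₂ 𝕜 (fun x z => D.act x (D.act z p) - D.act z (D.act x p) - D.act ⁅x, z⁆ p)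
    (fun a b c => by simp only [map_add, add_lie, LinearMap.add_apply]; abel)
    (fun c a b => by simp only [map_smul, smul_lie, LinearMap.smul_apply, smul_sub])
    (fun a b c => by simp only [map_add, lie_add, LinearMap.add_apply]; abel)
    (fun c a b => by simp only [map_smul, lie_smul, LinearMap.smul_apply, smul_sub])

lemma defect_apply (p : MvPolynomial I 𝕜) (x z : L) : D.defect p x z =
    D.act x (D.act z p) - D.act z (D.act x p) - D.act ⁅x, z⁆ p := rfl

lemma defect_skew (p : MvPolynomial I 𝕜) (x z : L) : D.defect p x z = -D.defect p z x := by
  rw [defect_apply, defect_apply, ← lie_skew, map_neg, LinearMap.neg_apply]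
  abel

lemma support_single_add {i y : I} {m : I →₀ ℕ} (hi : y ≤ i) (hy : ∀ j ∈ m.support, y ≤ j) :
    ∀ j ∈ (Finsupp.single i 1 + m).support, y ≤ j := by
  intro j hj
  rcases Finset.mem_union.mp (Finsupp.support_add hj) with hs | hm
  · exact (Finset.mem_singleton.mp (Finsupp.support_single_subset hs)) ▸ hi
  · exact hy j hm

/-- A statement linear in `p` holds for `D.act x p` when it holds in low degree and for the
monomials divisible by a variable larger than `y`. -/
lemma act_induction {y : I} {m : I →₀ ℕ} {x : L} (hx : D.cut y x = x)
    (N : Submodule 𝕜 (MvPolynomial I 𝕜)) (h₁ : ∀ m' : I →₀ ℕ, m'.degree ≤ m.degree →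
      monomial m' 1 ∈ N) (h₂ : ∀ i, y < i → X i * monomial m 1 ∈ N) :
    D.act x (monomial m 1) ∈ N := by
  rw [← sub_add_cancel (D.act x (monomial m 1)) (D.lin x * monomial m 1)]
  refine N.add_mem ?_ ?_
  · exact map_degLT_le LinearMap.id N (m.degree + 1)
      (fun m' hm' => h₁ m' (Nat.lt_succ_iff.mp hm'))
      (D.act_sub_mem (monomial_mem_degLT (Nat.lt_succ_self _)) x)
  · exact D.lin_of_cut hx (N.comap (LinearMap.mulRight 𝕜 (monomial m 1))) h₂

lemma defect_monomial (d : ℕ) : ∀ m : I →₀ ℕ, m.degree = d → D.defect (monomial m 1) = 0 := by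
  induction d using Nat.strong_induction_on with
  | _ d ih =>
  intro m hm
  have hf : ∀ j, (∀ i ∈ m.support, j ≤ i) → ∀ x, D.defect (monomial m 1) x (D.f j) = 0 := by
    intro j hj x
    rw [defect_apply, D.act_f_monomial hj, D.act_X_mul hj]
    abel
  have hf' : ∀ j, (∀ i ∈ m.support, j ≤ i) → ∀ x, D.defect (monomial m 1) (D.f j) x = 0 := by
    intro j hj x
    rw [defect_skew, hf j hj, neg_zero]
  by_cases h : m = 0
  · subst h
    ext1 x
    refine D.induction_ker (LinearMap.ker (D.defect (monomial 0 1)))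
      (fun i => by ext1 z; exact hf' i (by simp) z) (fun x hx => ?_) x
    rw [LinearMap.mem_ker]
    ext1 z
    refine D.induction_ker (LinearMap.ker (D.defect (monomial 0 1) x))
      (fun i => hf i (by simp) x) (fun z hz => ?_) z
    rw [LinearMap.mem_ker, defect_apply]
    have h1 : (monomial 0 1 : MvPolynomial I 𝕜) = 1 := rfl
    rw [h1, act_one, act_one, act_one, D.lin_eq_zero hx, D.lin_eq_zero hz,
      D.lin_eq_zero (D.π_lie x z hx hz), D.χ_lie x z hx hz]
    simp only [zero_add, map_smul, act_one, D.lin_eq_zero hx, D.lin_eq_zero hz]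
    simp [smul_smul, mul_comm]
  · obtain ⟨y, m', hy, rfl⟩ : ∃ (y : I) (m' : I →₀ ℕ), (∀ j ∈ m'.support, y ≤ j) ∧
        m = Finsupp.single y 1 + m' := ⟨_, _, minVar_le_tail h, (single_add_tail h).symm⟩
    have hd : m'.degree + 1 = d := by
      rw [← hm, map_add, Finsupp.degree_single, add_comm]
    have hym := support_single_add le_rfl hy
    have comm : ∀ x, D.cut y x = x → ∀ z,
        D.act z (D.act (D.f y) (D.act x (monomial m' 1))) =
          D.act (D.f y) (D.act z (D.act x (monomial m' 1))) +
          D.act ⁅z, D.f y⁆ (D.act x (monomial m' 1)) := by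
      intro x hx z
      have := D.act_induction (m := m') hx (LinearMap.ker
        (D.act z ∘ₗ D.act (D.f y) - D.act (D.f y) ∘ₗ D.act z - D.act ⁅z, D.f y⁆))
        (fun m'' hm'' => by
          have := LinearMap.congr_fun (LinearMap.congr_fun (ih m''.degree (by omega) m'' rfl) z)
            (D.f y)
          rw [defect_apply] at this
          simpa using this)
        (fun i hi => by
          have hym' := support_single_add hi.le hy
          rw [LinearMap.mem_ker]
          simp only [LinearMap.sub_apply, LinearMap.comp_apply]
          rw [X_mul_monomial, D.act_f_monomial hym', D.act_X_mul hym']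
          abel)
      rw [LinearMap.mem_ker] at this
      simp only [LinearMap.sub_apply, LinearMap.comp_apply] at this
      rw [sub_sub, sub_eq_zero] at this
      exact this
    have low : ∀ x z, D.act x (D.act z (monomial m' 1)) =
        D.act z (D.act x (monomial m' 1)) + D.act ⁅x, z⁆ (monomial m' 1) := by
      intro x z
      have := LinearMap.congr_fun (LinearMap.congr_fun (ih m'.degree (by omega) m' rfl) x) z
      rw [defect_apply, LinearMap.zero_apply, LinearMap.zero_apply, sub_sub, sub_eq_zero] at this
      exact this
    ext1 x
    refine D.induction_cut y (LinearMap.ker (D.defect _))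
      (fun i hi => by ext1 z; exact hf' i (fun j hj => hi.trans (hym j hj)) z) (fun x hx => ?_) x
    rw [LinearMap.mem_ker]
    ext1 z
    refine D.induction_cut y (LinearMap.ker (D.defect _ x))
      (fun i hi => hf i (fun j hj => hi.trans (hym j hj)) x) (fun z hz => ?_) z
    rw [LinearMap.mem_ker, defect_apply, ← X_mul_monomial, D.act_X_mul hy, D.act_X_mul hy,
      D.act_X_mul hy, map_add, map_add, comm z hz x, comm x hx z, low x z, map_add,
      low x ⁅z, D.f y⁆, low z ⁅x, D.f y⁆, lie_lie x z]
    simp only [map_sub, LinearMap.sub_apply]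
    abel

lemma act_lie (x z : L) (p : MvPolynomial I 𝕜) :
    D.act ⁅x, z⁆ p = D.act x (D.act z p) - D.act z (D.act x p) := by
  have : D.act ⁅x, z⁆ = D.act x ∘ₗ D.act z - D.act z ∘ₗ D.act x := by
    refine (basisMonomials I 𝕜).ext fun m => ?_
    have := LinearMap.congr_fun (LinearMap.congr_fun (D.defect_monomial _ m rfl) x) z
    rw [defect_apply, LinearMap.zero_apply, LinearMap.zero_apply, sub_eq_zero] at this
    rw [coe_basisMonomials]
    exact this.symm
  rw [this]
  rfl

attribute [local instance] LieRing.ofAssociativeRing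

/-- The representation of `L` on the polynomial ring. -/
noncomputable def rep : L →ₗ⁅𝕜⁆ Module.End 𝕜 (MvPolynomial I 𝕜) :=
  { D.act with
    map_lie' := fun {x z} => by
      refine LinearMap.ext fun p => ?_
      exact D.act_lie x z p }

lemma rep_apply (x : L) : D.rep x = D.act x := rfl

/-- The representation of the enveloping algebra on the polynomial ring. -/
noncomputable def toEnd :
    UniversalEnvelopingAlgebra 𝕜 L →ₐ[𝕜] Module.End 𝕜 (MvPolynomial I 𝕜) :=
  UniversalEnvelopingAlgebra.lift 𝕜 D.rep

lemma toEnd_ι (x : L) : D.toEnd (UniversalEnvelopingAlgebra.ι 𝕜 x) = D.act x := by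
  rw [toEnd, UniversalEnvelopingAlgebra.lift_ι_apply, rep_apply]

/-- The left ideal defining the induced module. -/
def ideal (D : InductionDatum 𝕜 L I) :
    Submodule (UniversalEnvelopingAlgebra 𝕜 L) (UniversalEnvelopingAlgebra 𝕜 L) :=
  Submodule.span _ {u | ∃ x, D.π x = 0 ∧
    u = UniversalEnvelopingAlgebra.ι 𝕜 x - algebraMap 𝕜 _ (D.χ x)}

/-- The sorted product attached to a monomial. -/
noncomputable def word (m : I →₀ ℕ) : UniversalEnvelopingAlgebra 𝕜 L :=
  (((Finsupp.toMultiset m).sort (· ≤ ·)).map fun i => UniversalEnvelopingAlgebra.ι 𝕜 (D.f i)).prod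

lemma word_zero : D.word 0 = 1 := by simp [word]

lemma word_single_add {i : I} {m : I →₀ ℕ} (hi : ∀ j ∈ m.support, i ≤ j) :
    D.word (Finsupp.single i 1 + m) = UniversalEnvelopingAlgebra.ι 𝕜 (D.f i) * D.word m := by
  rw [word, map_add, Finsupp.toMultiset_single, one_smul, Multiset.singleton_add,
    Multiset.sort_cons, List.map_cons, List.prod_cons, word]
  intro j hj
  exact hi j (by simpa using hj)

/-- Induction on monomials, peeling off the smallest variable. -/
lemma monomial_induction {P : (I →₀ ℕ) → Prop} (h₀ : P 0)
    (h₁ : ∀ (i : I) (m : I →₀ ℕ), (∀ j ∈ m.support, i ≤ j) →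
      (∀ m' : I →₀ ℕ, m'.degree ≤ m.degree → P m') → P (Finsupp.single i 1 + m)) (m : I →₀ ℕ) :
    P m := by
  induction hd : m.degree using Nat.strong_induction_on generalizing m with
  | _ d ih =>
  by_cases h : m = 0
  · rwa [h]
  · rw [← single_add_tail h]
    exact h₁ _ _ (minVar_le_tail h)
      fun m' hm' => ih _ (by have := degree_tail h; omega) m' rfl

lemma toEnd_word (m : I →₀ ℕ) : D.toEnd (D.word m) 1 = monomial m 1 := by
  induction m using monomial_induction with
  | h₀ => rw [word_zero, map_one D.toEnd]; rfl
  | h₁ i m hi ih =>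
    rw [D.word_single_add hi, map_mul, Module.End.mul_apply, ih m le_rfl, toEnd_ι,
      D.act_f_monomial hi, X_mul_monomial]

/-- The linear map sending a monomial to its sorted product. -/
noncomputable def ofPoly : MvPolynomial I 𝕜 →ₗ[𝕜] UniversalEnvelopingAlgebra 𝕜 L ⧸ D.ideal :=
  (basisMonomials I 𝕜).constr 𝕜 fun m => Submodule.Quotient.mk (D.word m)

lemma ofPoly_monomial (m : I →₀ ℕ) :
    D.ofPoly (monomial m 1) = Submodule.Quotient.mk (D.word m) := constr_monomial _ _

lemma ofPoly_X_mul {i : I} {m : I →₀ ℕ} (hi : ∀ j ∈ m.support, i ≤ j) :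
    D.ofPoly (X i * monomial m 1) =
      UniversalEnvelopingAlgebra.ι 𝕜 (D.f i) • D.ofPoly (monomial m 1) := by
  rw [X_mul_monomial, ofPoly_monomial, ofPoly_monomial, D.word_single_add hi]
  rfl

/-- `x ↦ ι x • v` as a linear map. -/
noncomputable def smulMap (v : UniversalEnvelopingAlgebra 𝕜 L ⧸ D.ideal) :
    L →ₗ[𝕜] UniversalEnvelopingAlgebra 𝕜 L ⧸ D.ideal :=
  (LinearMap.toSpanSingleton (UniversalEnvelopingAlgebra 𝕜 L) _ v).restrictScalars 𝕜 ∘ₗ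
    (UniversalEnvelopingAlgebra.ι 𝕜 : L →ₗ⁅𝕜⁆ UniversalEnvelopingAlgebra 𝕜 L).toLinearMap

lemma ofPoly_act_monomial (m : I →₀ ℕ) : ∀ x : L, D.ofPoly (D.act x (monomial m 1)) =
    UniversalEnvelopingAlgebra.ι 𝕜 x • D.ofPoly (monomial m 1) := by
  have key : ∀ m : I →₀ ℕ, ∀ x, x ∈ LinearMap.ker (D.ofPoly ∘ₗ D.act.flip (monomial m 1) -
      D.smulMap (D.ofPoly (monomial m 1))) ↔ D.ofPoly (D.act x (monomial m 1)) =
      UniversalEnvelopingAlgebra.ι 𝕜 x • D.ofPoly (monomial m 1) := by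
    intro m x
    rw [LinearMap.mem_ker, LinearMap.sub_apply, sub_eq_zero]
    rfl
  have hf : ∀ m : I →₀ ℕ, ∀ i, (∀ j ∈ m.support, i ≤ j) →
      D.ofPoly (D.act (D.f i) (monomial m 1)) =
        UniversalEnvelopingAlgebra.ι 𝕜 (D.f i) • D.ofPoly (monomial m 1) := by
    intro m i hi
    rw [D.act_f_monomial hi, D.ofPoly_X_mul hi]
  induction m using monomial_induction with
  | h₀ =>
    intro x
    rw [← key]
    refine D.induction_ker _ (fun i => (key _ _).mpr (hf 0 i (by simp)))
      (fun x hx => (key _ _).mpr ?_) x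
    have h1 : (monomial 0 1 : MvPolynomial I 𝕜) = 1 := rfl
    rw [h1, act_one, D.lin_eq_zero hx, zero_add, map_smul, ← h1, ofPoly_monomial, word_zero]
    rw [← Submodule.Quotient.mk_smul, ← Submodule.Quotient.mk_smul, eq_comm,
      Submodule.Quotient.eq]
    refine Submodule.subset_span ⟨x, hx, ?_⟩
    rw [smul_eq_mul, mul_one, Algebra.algebraMap_eq_smul_one]
  | h₁ y m hy ih =>
    intro x
    rw [← key]
    have hym := support_single_add le_rfl hy
    refine D.induction_cut y _ (fun i hi => (key _ _).mpr (hf _ i fun j hj => hi.trans (hym j hj)))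
      (fun x hx => (key _ _).mpr ?_) x
    have := D.act_induction (m := m) hx (LinearMap.ker (D.ofPoly ∘ₗ D.act (D.f y) -
      (LinearMap.lsmul 𝕜 _ (1 : 𝕜) ∘ₗ (Algebra.lsmul 𝕜 𝕜 _ (UniversalEnvelopingAlgebra.ι 𝕜 (D.f y)))
        ∘ₗ D.ofPoly)))
      (fun m' hm' => by
        rw [LinearMap.mem_ker, LinearMap.sub_apply, sub_eq_zero]
        have := ih m' hm' (D.f y)
        simpa using this)
      (fun i hi => by
        rw [LinearMap.mem_ker, LinearMap.sub_apply, sub_eq_zero]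
        have := hf (Finsupp.single i 1 + m) y (support_single_add hi.le hy)
        rw [X_mul_monomial]
        simpa using this)
    rw [LinearMap.mem_ker, LinearMap.sub_apply, sub_eq_zero] at this
    have h2 : D.ofPoly (D.act (D.f y) (D.act x (monomial m 1))) =
        UniversalEnvelopingAlgebra.ι 𝕜 (D.f y) • D.ofPoly (D.act x (monomial m 1)) := by
      simpa using this
    rw [← X_mul_monomial, D.act_X_mul hy, map_add, h2, ih m le_rfl, ih m le_rfl, D.ofPoly_X_mul hy,
      smul_smul, smul_smul, ← add_smul]
    congr 1
    rw [LieHom.map_lie, LieRing.of_associative_ring_bracket]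
    abel

lemma envelope_induction {P : UniversalEnvelopingAlgebra 𝕜 L → Prop}
    (hι : ∀ x, P (UniversalEnvelopingAlgebra.ι 𝕜 x)) (hc : ∀ c : 𝕜, P (algebraMap 𝕜 _ c))
    (ha : ∀ u v, P u → P v → P (u + v)) (hm : ∀ u v, P u → P v → P (u * v))
    (u : UniversalEnvelopingAlgebra 𝕜 L) : P u := by
  let A : Subalgebra 𝕜 (UniversalEnvelopingAlgebra 𝕜 L) :=
    { carrier := {u | P u}
      mul_mem' := fun {a b} => hm a b
      add_mem' := fun {a b} => ha a b
      algebraMap_mem' := hc }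
  let φ : L →ₗ⁅𝕜⁆ A :=
    { toFun := fun x => ⟨UniversalEnvelopingAlgebra.ι 𝕜 x, hι x⟩
      map_add' := fun x y => Subtype.ext (map_add _ x y)
      map_smul' := fun c x => Subtype.ext (map_smul _ c x)
      map_lie' := fun {x y} => Subtype.ext (LieHom.map_lie _ x y) }
  have h : A.val.comp (UniversalEnvelopingAlgebra.lift 𝕜 φ) = AlgHom.id 𝕜 _ := by
    refine UniversalEnvelopingAlgebra.hom_ext 𝕜 (LieHom.ext fun x => ?_)
    show A.val (UniversalEnvelopingAlgebra.lift 𝕜 φ (UniversalEnvelopingAlgebra.ι 𝕜 x)) = _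
    rw [UniversalEnvelopingAlgebra.lift_ι_apply]
    rfl
  have h2 := DFunLike.congr_fun h u
  rw [AlgHom.id_apply] at h2
  rw [← h2]
  exact (UniversalEnvelopingAlgebra.lift 𝕜 φ u).2

lemma ofPoly_act (x : L) (p : MvPolynomial I 𝕜) :
    D.ofPoly (D.act x p) = UniversalEnvelopingAlgebra.ι 𝕜 x • D.ofPoly p := by
  have : D.ofPoly ∘ₗ D.act x =
      (Algebra.lsmul 𝕜 𝕜 _ (UniversalEnvelopingAlgebra.ι 𝕜 x)) ∘ₗ D.ofPoly := by
    refine (basisMonomials I 𝕜).ext fun m => ?_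
    rw [coe_basisMonomials]
    exact D.ofPoly_act_monomial m x
  exact LinearMap.congr_fun this p

lemma ofPoly_toEnd (u : UniversalEnvelopingAlgebra 𝕜 L) :
    ∀ p : MvPolynomial I 𝕜, D.ofPoly (D.toEnd u p) = u • D.ofPoly p := by
  induction u using envelope_induction with
  | hι x => intro p; rw [toEnd_ι, ofPoly_act]
  | hc c =>
    intro p
    rw [AlgHom.commutes D.toEnd, Module.algebraMap_end_apply, map_smul, algebraMap_smul]
  | ha u v hu hv => intro p; rw [map_add D.toEnd, LinearMap.add_apply, map_add, hu, hv, add_smul]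
  | hm u v hu hv => intro p; rw [map_mul D.toEnd, Module.End.mul_apply, hu, hv, mul_smul]

lemma toEnd_eq_zero {u : UniversalEnvelopingAlgebra 𝕜 L} (hu : u ∈ D.ideal) :
    D.toEnd u 1 = 0 := by
  induction hu using Submodule.span_induction with
  | mem u h =>
    obtain ⟨x, hx, rfl⟩ := h
    rw [map_sub D.toEnd, AlgHom.commutes D.toEnd, toEnd_ι, LinearMap.sub_apply, act_one,
      D.lin_eq_zero hx, Module.algebraMap_end_apply, zero_add, sub_self]
  | zero => simp
  | add u v _ _ hu hv => rw [map_add D.toEnd, LinearMap.add_apply, hu, hv, add_zero]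
  | smul a u _ hu =>
    rw [smul_eq_mul, map_mul D.toEnd, Module.End.mul_apply, hu, map_zero]

/-- The induced module is identified with the polynomial ring. -/
lemma mem_ideal_iff (u : UniversalEnvelopingAlgebra 𝕜 L) : u ∈ D.ideal ↔ D.toEnd u 1 = 0 := by
  refine ⟨D.toEnd_eq_zero, fun h => ?_⟩
  have := D.ofPoly_toEnd u 1
  have h1 : (1 : MvPolynomial I 𝕜) = monomial 0 1 := rfl
  rw [h, map_zero, h1, ofPoly_monomial, word_zero, ← Submodule.Quotient.mk_smul, smul_eq_mul,
    mul_one] at this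
  exact (Submodule.Quotient.mk_eq_zero _).mp this.symm

lemma exists_toEnd_eq (p : MvPolynomial I 𝕜) : ∃ u, D.toEnd u 1 = p := by
  induction p using MvPolynomial.induction_on' with
  | monomial m a =>
    refine ⟨algebraMap 𝕜 _ a * D.word m, ?_⟩
    rw [map_mul D.toEnd, Module.End.mul_apply, toEnd_word, AlgHom.commutes D.toEnd,
      Module.algebraMap_end_apply, smul_monomial, smul_eq_mul, mul_one]
  | add p q hp hq =>
    obtain ⟨u, rfl⟩ := hp
    obtain ⟨v, rfl⟩ := hq
    exact ⟨u + v, by rw [map_add D.toEnd, LinearMap.add_apply]⟩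

/-- The derivation giving the leading term of the action of an element of `ker π`. -/
noncomputable def symb (x : L) : Derivation 𝕜 (MvPolynomial I 𝕜) (MvPolynomial I 𝕜) :=
  mkDerivation 𝕜 fun i => D.lin ⁅x, D.f i⁆

lemma symb_X_mul (x : L) (i : I) (p : MvPolynomial I 𝕜) :
    D.symb x (X i * p) = X i * D.symb x p + D.lin ⁅x, D.f i⁆ * p := by
  rw [Derivation.leibniz, symb, mkDerivation_X, smul_eq_mul, smul_eq_mul, mul_comm p]

lemma act_sub_symb_mem_monomial {x : L} (hx : D.π x = 0) (m : I →₀ ℕ) :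
    D.act x (monomial m 1) - (D.symb x (monomial m 1) + D.χ x • monomial m 1) ∈
      degLT 𝕜 I m.degree := by
  induction m using monomial_induction with
  | h₀ =>
    have h1 : (monomial 0 1 : MvPolynomial I 𝕜) = 1 := rfl
    rw [h1, act_one, D.lin_eq_zero hx, Derivation.map_one_eq_zero, sub_self]
    exact zero_mem _
  | h₁ y m hy ih =>
    have hm := ih m le_rfl
    have hd : (Finsupp.single y 1 + m).degree = m.degree + 1 := by
      rw [map_add, Finsupp.degree_single, add_comm]
    have hmm : monomial m (1 : 𝕜) ∈ degLT 𝕜 I (m.degree + 1) :=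
      monomial_mem_degLT (Nat.lt_succ_self _)
    have h1 : D.act x (monomial m 1) ∈ degLT 𝕜 I (m.degree + 1) := by
      have := D.act_sub_mem hmm x
      rwa [D.lin_eq_zero hx, zero_mul, sub_zero] at this
    have h2 := D.act_sub_mem h1 (D.f y)
    have h3 := D.act_sub_mem hmm ⁅x, D.f y⁆
    have h4 := X_mul_mem_degLT y hm
    rw [hd, ← X_mul_monomial, D.act_X_mul hy, symb_X_mul]
    rw [lin_f] at h2
    have := add_mem (add_mem h2 h3) h4
    convert this using 1
    simp only [smul_eq_C_mul]
    ring

lemma act_sub_symb_mem {x : L} (hx : D.π x = 0) {d : ℕ} {p : MvPolynomial I 𝕜}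
    (hp : p ∈ degLT 𝕜 I (d + 1)) :
    D.act x p - (D.symb x p + D.χ x • p) ∈ degLT 𝕜 I d := by
  have := map_degLT_le (D.act x - ((D.symb x : MvPolynomial I 𝕜 →ₗ[𝕜] MvPolynomial I 𝕜) +
    D.χ x • LinearMap.id)) (degLT 𝕜 I d) (d + 1)
    (fun m hm => by
      simp only [LinearMap.sub_apply, LinearMap.add_apply, LinearMap.smul_apply,
        LinearMap.id_apply, Derivation.coeFn_coe]
      exact degLT_mono (Nat.lt_succ_iff.mp hm) (D.act_sub_symb_mem_monomial hx m)) hp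
  simpa only [LinearMap.sub_apply, LinearMap.add_apply, LinearMap.smul_apply,
    LinearMap.id_apply, Derivation.coeFn_coe] using this

lemma lin_isHomogeneous (x : L) : (D.lin x).IsHomogeneous 1 := by
  rw [lin, LinearMap.comp_apply, Finsupp.linearCombination_apply, Finsupp.sum]
  refine IsHomogeneous.sum _ _ _ fun i _ => ?_
  rw [smul_eq_C_mul]
  simpa using (isHomogeneous_C I (D.π x i)).mul (isHomogeneous_X 𝕜 i)

lemma symb_monomial_isHomogeneous (x : L) (m : I →₀ ℕ) :
    (D.symb x (monomial m 1)).IsHomogeneous m.degree := by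
  induction m using monomial_induction with
  | h₀ =>
    have h1 : (monomial 0 1 : MvPolynomial I 𝕜) = 1 := rfl
    rw [h1, Derivation.map_one_eq_zero]
    exact isHomogeneous_zero _ _ _
  | h₁ y m hy ih =>
    rw [map_add, Finsupp.degree_single, ← X_mul_monomial, symb_X_mul]
    exact ((isHomogeneous_X 𝕜 y).mul (ih m le_rfl)).add
      ((D.lin_isHomogeneous _).mul (isHomogeneous_monomial 1 rfl))

lemma homogeneousComponent_symb (x : L) (d : ℕ) (p : MvPolynomial I 𝕜) :
    homogeneousComponent d (D.symb x p) = D.symb x (homogeneousComponent d p) := by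
  have : homogeneousComponent d ∘ₗ (D.symb x : MvPolynomial I 𝕜 →ₗ[𝕜] MvPolynomial I 𝕜) =
      (D.symb x : MvPolynomial I 𝕜 →ₗ[𝕜] MvPolynomial I 𝕜) ∘ₗ homogeneousComponent d := by
    refine (basisMonomials I 𝕜).ext fun m => ?_
    rw [coe_basisMonomials, LinearMap.comp_apply, LinearMap.comp_apply,
      homogeneousComponent_of_mem (isHomogeneous_monomial (R := 𝕜) 1 rfl : _ ∈ _)]
    have := homogeneousComponent_of_mem (m := d)
      ((mem_homogeneousSubmodule _ _).mpr (D.symb_monomial_isHomogeneous x m))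
    rw [Derivation.coeFn_coe, this]
    split_ifs <;> simp
  exact LinearMap.congr_fun this p

lemma homogeneousComponent_eq_zero_of_mem_degLT {d : ℕ} {p : MvPolynomial I 𝕜}
    (hp : p ∈ degLT 𝕜 I d) : homogeneousComponent d p = 0 :=
  eq_on_degLT (homogeneousComponent d) 0 d (fun m hm => by
    rw [homogeneousComponent_of_mem (isHomogeneous_monomial (R := 𝕜) 1 rfl : _ ∈ _),
      if_neg hm.ne', LinearMap.zero_apply]) hp

lemma mem_degLT_totalDegree (p : MvPolynomial I 𝕜) : p ∈ degLT 𝕜 I (p.totalDegree + 1) := by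
  have h : ∀ m ∈ p.support, monomial m (p.coeff m) ∈ degLT 𝕜 I (p.totalDegree + 1) := by
    intro m hm
    rw [← mul_one (p.coeff m), ← smul_eq_mul, ← smul_monomial]
    exact Submodule.smul_mem _ _ (monomial_mem_degLT (Nat.lt_succ_iff.mpr (le_totalDegree hm)))
  have := sum_mem h
  rwa [support_sum_monomial_coeff] at this

/-- The leading form of a vector killed by `x ∈ ker π` is killed by the leading term of `x`. -/
lemma symb_leading_eq_zero {x : L} (hx : D.π x = 0) (hχ : D.χ x = 0) {p : MvPolynomial I 𝕜}
    (hp : D.act x p = 0) : D.symb x (homogeneousComponent p.totalDegree p) = 0 := by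
  have := homogeneousComponent_eq_zero_of_mem_degLT
    (D.act_sub_symb_mem hx (mem_degLT_totalDegree p))
  rw [hp, hχ, zero_smul, add_zero, zero_sub, map_neg, neg_eq_zero, homogeneousComponent_symb] at this
  exact this

lemma mk_eq_ofPoly (u : UniversalEnvelopingAlgebra 𝕜 L) :
    (Submodule.Quotient.mk u : UniversalEnvelopingAlgebra 𝕜 L ⧸ D.ideal) =
      D.ofPoly (D.toEnd u 1) := by
  have h1 : (1 : MvPolynomial I 𝕜) = monomial 0 1 := rfl
  rw [D.ofPoly_toEnd, h1, ofPoly_monomial, word_zero, ← Submodule.Quotient.mk_smul, smul_eq_mul,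
    mul_one]

lemma ofPoly_bijective : Function.Bijective D.ofPoly := by
  refine ⟨(injective_iff_map_eq_zero _).mpr fun p hp => ?_, fun v => ?_⟩
  · obtain ⟨u, rfl⟩ := D.exists_toEnd_eq p
    rw [← mk_eq_ofPoly, Submodule.Quotient.mk_eq_zero] at hp
    exact D.toEnd_eq_zero hp
  · induction v using Submodule.Quotient.induction_on with
    | H u => exact ⟨_, (D.mk_eq_ofPoly u).symm⟩

section Morphism

variable {L' I' : Type*} [LieRing L'] [LieAlgebra 𝕜 L'] [LinearOrder I']
  (D' : InductionDatum 𝕜 L' I') (j : L' →ₗ⁅𝕜⁆ L) (e : I' ↪o I)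

/-- Functoriality of the enveloping algebra. -/
noncomputable def mapEnvelope :
    UniversalEnvelopingAlgebra 𝕜 L' →ₐ[𝕜] UniversalEnvelopingAlgebra 𝕜 L :=
  UniversalEnvelopingAlgebra.lift 𝕜 ((UniversalEnvelopingAlgebra.ι 𝕜).comp j)

lemma mapEnvelope_ι (x : L') : mapEnvelope j (UniversalEnvelopingAlgebra.ι 𝕜 x) =
    UniversalEnvelopingAlgebra.ι 𝕜 (j x) := by
  rw [mapEnvelope, UniversalEnvelopingAlgebra.lift_ι_apply]
  rfl

/-- Compatibility of two induction data along a Lie algebra map. -/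
structure Compatible : Prop where
  f : ∀ i, j (D'.f i) = D.f (e i)
  π : ∀ x, D'.π x = 0 → D.π (j x) = 0
  χ : ∀ x, D'.π x = 0 → D.χ (j x) = D'.χ x

variable {D D' j e}

lemma Compatible.mapEnvelope_word (h : Compatible D D' j e) (m : I' →₀ ℕ) :
    mapEnvelope j (D'.word m) = D.word (m.embDomain e.toEmbedding) := by
  induction m using monomial_induction with
  | h₀ => rw [word_zero, map_one (mapEnvelope j), Finsupp.embDomain_zero, word_zero]
  | h₁ i m hi ih =>
    rw [D'.word_single_add hi, map_mul (mapEnvelope j), ih m le_rfl, mapEnvelope_ι, h.f,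
      ← D.word_single_add]
    · congr 1
      rw [Finsupp.embDomain_add, Finsupp.embDomain_single]
      rfl
    · intro k hk
      rw [Finsupp.support_embDomain, Finset.mem_map] at hk
      obtain ⟨k, hk, rfl⟩ := hk
      exact e.monotone (hi k hk)

lemma Compatible.mapEnvelope_mem (h : Compatible D D' j e) {u : UniversalEnvelopingAlgebra 𝕜 L'}
    (hu : u ∈ D'.ideal) : mapEnvelope j u ∈ D.ideal := by
  induction hu using Submodule.span_induction with
  | mem u hu =>
    obtain ⟨x, hx, rfl⟩ := hu
    refine Submodule.subset_span ⟨j x, h.π x hx, ?_⟩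
    rw [map_sub (mapEnvelope j), mapEnvelope_ι, AlgHom.commutes (mapEnvelope j), h.χ x hx]
  | zero => rw [map_zero (mapEnvelope j)]; exact zero_mem _
  | add u v _ _ hu hv => rw [map_add (mapEnvelope j)]; exact add_mem hu hv
  | smul a u _ hu =>
    rw [smul_eq_mul, map_mul (mapEnvelope j)]
    exact Submodule.smul_mem _ _ hu

lemma Compatible.toEnd_mapEnvelope (h : Compatible D D' j e)
    (u : UniversalEnvelopingAlgebra 𝕜 L') :
    D.toEnd (mapEnvelope j u) 1 = rename e (D'.toEnd u 1) := by
  have key : ∀ p : MvPolynomial I' 𝕜, ∃ u, D'.toEnd u 1 = p ∧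
      D.toEnd (mapEnvelope j u) 1 = rename e p := by
    intro p
    induction p using MvPolynomial.induction_on' with
    | monomial m a =>
      refine ⟨algebraMap 𝕜 _ a * D'.word m, ?_, ?_⟩
      · rw [map_mul D'.toEnd, Module.End.mul_apply, toEnd_word, AlgHom.commutes D'.toEnd,
          Module.algebraMap_end_apply, smul_monomial, smul_eq_mul, mul_one]
      · rw [map_mul (mapEnvelope j), AlgHom.commutes (mapEnvelope j), map_mul D.toEnd,
          Module.End.mul_apply, h.mapEnvelope_word, toEnd_word, AlgHom.commutes D.toEnd,
          Module.algebraMap_end_apply, smul_monomial, smul_eq_mul, mul_one, rename_monomial,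
          Finsupp.embDomain_eq_mapDomain]
        rfl
    | add p q hp hq =>
      obtain ⟨u, rfl, hu⟩ := hp
      obtain ⟨v, rfl, hv⟩ := hq
      refine ⟨u + v, by rw [map_add D'.toEnd, LinearMap.add_apply], ?_⟩
      rw [map_add (mapEnvelope j), map_add D.toEnd, LinearMap.add_apply, hu, hv, map_add]
  obtain ⟨v, hv, hv'⟩ := key (D'.toEnd u 1)
  rw [← hv']
  have hm : u - v ∈ D'.ideal := by
    rw [mem_ideal_iff, map_sub D'.toEnd, LinearMap.sub_apply, hv, sub_self]
  have := D.toEnd_eq_zero (h.mapEnvelope_mem hm)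
  rwa [map_sub (mapEnvelope j), map_sub D.toEnd, LinearMap.sub_apply, sub_eq_zero] at this

lemma Compatible.act_rename (h : Compatible D D' j e) (x : L') (p : MvPolynomial I' 𝕜) :
    D.act (j x) (rename e p) = rename e (D'.act x p) := by
  obtain ⟨u, rfl⟩ := D'.exists_toEnd_eq p
  rw [← h.toEnd_mapEnvelope, ← toEnd_ι, ← toEnd_ι, ← Module.End.mul_apply, ← Module.End.mul_apply,
    ← map_mul D'.toEnd, ← h.toEnd_mapEnvelope, map_mul (mapEnvelope j), mapEnvelope_ι,
    map_mul D.toEnd]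

end Morphism

end InductionDatum

end

namespace RootReductive

attribute [local instance] LieRing.ofAssociativeRing

variable (S : RootReductive K g)

lemma lie_h_h {x y : g} (hx : x ∈ S.h) (hy : y ∈ S.h) : ⁅x, y⁆ = 0 := by
  have h1 := S.τ_anti x y
  rw [S.τ_h _ (S.h.lie_mem hx hy), S.τ_h _ hx, S.τ_h _ hy, ← lie_skew x y] at h1
  have h2 : (2 : K) • ⁅y, x⁆ = 0 := by
    rw [two_smul]
    exact neg_eq_iff_add_eq_zero.mp h1
  rw [← lie_skew, (smul_eq_zero.mp h2).resolve_left two_ne_zero, neg_zero]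

lemma h_le_rootSp_zero : S.h.toSubmodule ≤ rootSp K g S.h 0 := fun x hx H => by
  rw [S.lie_h_h H.2 hx]; simp

lemma lie_mem_rootSp {h : LieSubalgebra K g} {α β : Module.Dual K h} {x y : g}
    (hx : x ∈ rootSp K g h α) (hy : y ∈ rootSp K g h β) : ⁅x, y⁆ ∈ rootSp K g h (α + β) := by
  intro H
  rw [leibniz_lie, hx H, hy H, smul_lie, lie_smul, ← add_smul]
  rfl

/-- A subspace stable under `h` contains the weight components of its elements. -/
lemma component_mem {h : LieSubalgebra K g} (N : Submodule K g)
    (hN : ∀ H : h, ∀ x ∈ N, ⁅(H : g), x⁆ ∈ N) (F : Finset (Module.Dual K h)) :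
    ∀ x : Module.Dual K h → g, (∀ χ ∈ F, x χ ∈ rootSp K g h χ) → ∑ χ ∈ F, x χ ∈ N →
      ∀ χ ∈ F, x χ ∈ N := by
  classical
  induction F using Finset.induction_on with
  | empty => intro x _ _ χ hχ; simp at hχ
  | insert a F ha ih =>
    intro x hx hs
    have hF : ∀ χ ∈ F, x χ ∈ N := by
      intro χ hχ
      have hne : χ ≠ a := fun h => ha (h ▸ hχ)
      obtain ⟨H, hH⟩ : ∃ H, χ H ≠ a H := by
        by_contra! hc
        exact hne (LinearMap.ext hc)
      have := ih (fun χ => (χ H - a H) • x χ)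
        (fun χ hχ => Submodule.smul_mem _ _ (hx χ (Finset.mem_insert_of_mem hχ))) ?_ χ hχ
      · exact (N.smul_mem_iff (sub_ne_zero.mpr hH)).mp this
      · have h1 := N.sub_mem (hN H _ hs) (N.smul_mem (a H) hs)
        rw [Finset.sum_insert ha, lie_add, smul_add, hx a (Finset.mem_insert_self _ _) H,
          add_sub_add_left_eq_sub, lie_sum, Finset.smul_sum, ← Finset.sum_sub_distrib] at h1
        convert h1 using 1
        refine Finset.sum_congr rfl fun χ hχ => ?_
        rw [hx χ (Finset.mem_insert_of_mem hχ) H, sub_smul]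
    intro χ hχ
    rcases Finset.mem_insert.mp hχ with rfl | h
    · rw [Finset.sum_insert ha] at hs
      exact (N.add_mem_iff_left (N.sum_mem hF)).mp hs
    · exact hF χ h

lemma iSupIndep_rootSp (h : LieSubalgebra K g) : iSupIndep fun χ => rootSp K g h χ := by
  rw [iSupIndep_iff_finsetSum_eq_zero_imp_eq_zero]
  intro F x hx h0 χ hχ
  simpa using component_mem (⊥ : Submodule K g) (by simp) F x hx (by simpa using h0) χ hχ

lemma finrank_rootSp {α : Module.Dual K S.h} (hα : α ∈ S.Φ) :
    Module.finrank K (rootSp K g S.h α) = 1 :=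
  Module.rank_eq_one_iff_finrank_eq_one.mp (S.root_dim α hα)

lemma neg_mem {α : Module.Dual K S.h} (hα : α ∈ S.Φp) : -α ∈ S.Φ := by
  rw [S.pos_union]
  exact Or.inr (by simpa using hα)

lemma pos_or_neg {α : Module.Dual K S.h} (hα : α ∈ S.Φ) : α ∈ S.Φp ∨ -α ∈ S.Φp := by
  rw [S.pos_union] at hα
  exact hα

lemma neg_not_mem {α : Module.Dual K S.h} (hα : α ∈ S.Φp) : -α ∉ S.Φp := fun h =>
  Set.disjoint_left.mp S.pos_disjoint hα h

lemma ne_zero_of_pos {α : Module.Dual K S.h} (hα : α ∈ S.Φp) : α ≠ 0 :=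
  ((S.root_iff α).mp (S.pos_subset hα)).1

lemma rootSp_eq_bot {χ : Module.Dual K S.h} (h0 : χ ≠ 0) (h1 : χ ∉ S.Φp) (h2 : -χ ∉ S.Φp) :
    rootSp K g S.h χ = ⊥ := by
  by_contra h
  rcases S.pos_or_neg ((S.root_iff χ).mpr ⟨h0, h⟩) with h | h
  · exact h1 h
  · exact h2 h

lemma iSup_rootSp : ⨆ χ, rootSp K g S.h χ = ⊤ := by
  rw [eq_top_iff, ← S.rootdec]
  exact sup_le (S.h_le_rootSp_zero.trans (le_iSup (fun χ => rootSp K g S.h χ) 0))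
    (iSup₂_le fun α _ => le_iSup (fun χ => rootSp K g S.h χ) α)

lemma root_induction (N : Submodule K g) (hN : ∀ χ, ∀ x ∈ rootSp K g S.h χ, x ∈ N) (x : g) :
    x ∈ N := by
  have h : ⨆ χ, rootSp K g S.h χ ≤ N := iSup_le fun χ x hx => hN χ x hx
  rw [iSup_rootSp] at h
  exact h trivial

open scoped Classical in
lemma isInternal_rootSp : DirectSum.IsInternal fun χ => rootSp K g S.h χ :=
  DirectSum.isInternal_submodule_of_iSupIndep_of_iSup_eq_top (iSupIndep_rootSp S.h) S.iSup_rootSp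

open scoped Classical in
/-- The decomposition of `g` into root spaces. -/
def decomp : (DirectSum (Module.Dual K S.h) fun χ => rootSp K g S.h χ) ≃ₗ[K] g :=
  LinearEquiv.ofBijective (DirectSum.coeLinearMap fun χ => rootSp K g S.h χ)
    (show Function.Bijective (DirectSum.coeLinearMap fun χ => rootSp K g S.h χ) from
      S.isInternal_rootSp)

open scoped Classical in
/-- The linear map on `g` with prescribed restrictions to the root spaces. -/
def glue {W : Type*} [AddCommGroup W] [Module K W] (φ : ∀ χ, rootSp K g S.h χ →ₗ[K] W) :
    g →ₗ[K] W :=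
  DirectSum.toModule K _ W φ ∘ₗ S.decomp.symm.toLinearMap

lemma glue_of_mem {W : Type*} [AddCommGroup W] [Module K W]
    (φ : ∀ χ, rootSp K g S.h χ →ₗ[K] W) {χ : Module.Dual K S.h} {x : g}
    (hx : x ∈ rootSp K g S.h χ) : S.glue φ x = φ χ ⟨x, hx⟩ := by
  classical
  have : S.decomp.symm x = DirectSum.lof K _ (fun χ => rootSp K g S.h χ) χ ⟨x, hx⟩ := by
    rw [LinearEquiv.symm_apply_eq, decomp, LinearEquiv.ofBijective_apply,
      DirectSum.coeLinearMap_lof]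
  rw [glue, LinearMap.comp_apply, LinearEquiv.coe_coe, this]
  convert DirectSum.toModule_lof K χ (φ := φ) ⟨x, hx⟩

lemma rootSp_zero_le : rootSp K g S.h 0 ≤ S.h.toSubmodule := by
  intro x hx
  have h1 : x ∈ S.h.toSubmodule ⊔ (⨆ α ∈ S.Φ, rootSp K g S.h α) := by rw [S.rootdec]; trivial
  obtain ⟨H, hH, y, hy, rfl⟩ := Submodule.mem_sup.mp h1
  have h2 : y ∈ ⨆ χ, ⨆ (_ : χ ≠ 0), rootSp K g S.h χ :=
    (iSup₂_le fun α hα => le_iSup₂ (f := fun χ (_ : χ ≠ 0) => rootSp K g S.h χ) α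
      ((S.root_iff α).mp hα).1 : (⨆ α ∈ S.Φ, rootSp K g S.h α) ≤ _) hy
  have h3 : y ∈ rootSp K g S.h 0 := by
    simpa using Submodule.sub_mem _ hx (S.h_le_rootSp_zero hH)
  have := Submodule.disjoint_def.mp (iSupIndep_rootSp S.h 0) y h3 h2
  simpa [this] using hH

lemma exists_components (x : g) : ∃ (F : Finset (Module.Dual K S.h)) (y : Module.Dual K S.h → g),
    (∀ χ, y χ ∈ rootSp K g S.h χ) ∧ ∑ χ ∈ F, y χ = x := by
  obtain ⟨y, hy, hx⟩ := (Submodule.mem_iSup_iff_exists_finsupp _ _).mp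
    (show x ∈ ⨆ χ, rootSp K g S.h χ by rw [iSup_rootSp]; trivial)
  exact ⟨y.support, y, hy, hx⟩

lemma exists_ne_zero {α : Module.Dual K S.h} (hα : α ∈ S.Φ) :
    ∃ x ∈ rootSp K g S.h α, x ≠ 0 :=
  (Submodule.ne_bot_iff _).mp ((S.root_iff α).mp hα).2

lemma rootSp_eq_span {α : Module.Dual K S.h} (hα : α ∈ S.Φ) {e : g}
    (he : e ∈ rootSp K g S.h α) (h0 : e ≠ 0) {x : g} (hx : x ∈ rootSp K g S.h α) :
    ∃ c : K, c • e = x := by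
  obtain ⟨c, hc⟩ := exists_smul_eq_of_finrank_eq_one (S.finrank_rootSp hα)
    (x := (⟨e, he⟩ : rootSp K g S.h α)) (by simpa using h0) ⟨x, hx⟩
  exact ⟨c, congrArg Subtype.val hc⟩

lemma exists_coord {α : Module.Dual K S.h} (hα : α ∈ S.Φ) :
    ∃ (e : g) (c : rootSp K g S.h α →ₗ[K] K), e ∈ rootSp K g S.h α ∧ e ≠ 0 ∧
      ∀ x, c x • e = x.1 := by
  obtain ⟨e, he, h0⟩ := S.exists_ne_zero hα
  let i : K →ₗ[K] rootSp K g S.h α := LinearMap.toSpanSingleton K _ ⟨e, he⟩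
  have hi : Function.Bijective i := by
    constructor
    · rw [← LinearMap.ker_eq_bot, LinearMap.ker_toSpanSingleton]
      simpa using h0
    · rintro ⟨x, hx⟩
      obtain ⟨c, rfl⟩ := S.rootSp_eq_span hα he h0 hx
      exact ⟨c, rfl⟩
  refine ⟨e, (LinearEquiv.ofBijective i hi).symm, he, h0, fun x => ?_⟩
  exact congrArg Subtype.val ((LinearEquiv.ofBijective i hi).apply_symm_apply x)

/-- A basis vector of a root space. -/
def rootVec {α : Module.Dual K S.h} (hα : α ∈ S.Φ) : g := (S.exists_coord hα).choose

/-- The coordinate with respect to `rootVec`. -/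
def coord {α : Module.Dual K S.h} (hα : α ∈ S.Φ) : rootSp K g S.h α →ₗ[K] K :=
  (S.exists_coord hα).choose_spec.choose

lemma rootVec_mem {α : Module.Dual K S.h} (hα : α ∈ S.Φ) : S.rootVec hα ∈ rootSp K g S.h α :=
  (S.exists_coord hα).choose_spec.choose_spec.1

lemma rootVec_ne_zero {α : Module.Dual K S.h} (hα : α ∈ S.Φ) : S.rootVec hα ≠ 0 :=
  (S.exists_coord hα).choose_spec.choose_spec.2.1

lemma coord_smul {α : Module.Dual K S.h} (hα : α ∈ S.Φ) (x : rootSp K g S.h α) :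
    S.coord hα x • S.rootVec hα = x :=
  (S.exists_coord hα).choose_spec.choose_spec.2.2 x

/-- The chosen basis vector of the root space of a negative root. -/
def negVec (α : S.Φp) : g := S.rootVec (S.neg_mem α.2)

lemma negVec_mem (α : S.Φp) : S.negVec α ∈ rootSp K g S.h (-α.1) := S.rootVec_mem _

lemma negVec_ne_zero (α : S.Φp) : S.negVec α ≠ 0 := S.rootVec_ne_zero _

open scoped Classical in
/-- The coordinates of the component of an element of `g` in the negative root spaces. -/
def negPart : g →ₗ[K] (S.Φp →₀ K) :=
  S.glue fun χ => if h : -χ ∈ S.Φp then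
    Finsupp.lsingle ⟨-χ, h⟩ ∘ₗ S.coord (by simpa using S.neg_mem h) else 0

lemma negPart_of_neg (α : S.Φp) {x : g} (hx : x ∈ rootSp K g S.h (-α.1)) :
    ∃ c : K, S.negPart x = Finsupp.single α c ∧ c • S.negVec α = x := by
  refine ⟨S.coord (S.neg_mem α.2) ⟨x, hx⟩, ?_, S.coord_smul _ ⟨x, hx⟩⟩
  have h : - -α.1 ∈ S.Φp := by simp
  rw [negPart, S.glue_of_mem _ hx, dif_pos h]
  have : (⟨- -α.1, h⟩ : S.Φp) = α := Subtype.ext (neg_neg _)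
  rw [LinearMap.comp_apply, this]
  rfl

lemma negPart_negVec (α : S.Φp) : S.negPart (S.negVec α) = Finsupp.single α 1 := by
  obtain ⟨c, hc, h⟩ := S.negPart_of_neg α (S.negVec_mem α)
  have h1 : (c - 1) • S.negVec α = 0 := by rw [sub_smul, h, one_smul, sub_self]
  rw [hc, sub_eq_zero.mp ((smul_eq_zero.mp h1).resolve_right (S.negVec_ne_zero α))]

lemma negPart_of_not_neg {χ : Module.Dual K S.h} (hχ : -χ ∉ S.Φp) {x : g}
    (hx : x ∈ rootSp K g S.h χ) : S.negPart x = 0 := by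
  rw [negPart, S.glue_of_mem _ hx, dif_neg hχ, LinearMap.zero_apply]

lemma b_eq : S.b.toSubmodule = S.h.toSubmodule ⊔ S.nplus := S.b_def

lemma sub_negPart_mem (x : g) :
    x - Finsupp.linearCombination K S.negVec (S.negPart x) ∈ S.b.toSubmodule := by
  let T : g →ₗ[K] g := LinearMap.id - Finsupp.linearCombination K S.negVec ∘ₗ S.negPart
  refine S.root_induction (S.b.toSubmodule.comap T) (fun χ y hy => ?_) x
  show y - Finsupp.linearCombination K S.negVec (S.negPart y) ∈ S.b.toSubmodule
  by_cases h1 : -χ ∈ S.Φp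
  · obtain ⟨c, hc, h⟩ := S.negPart_of_neg ⟨-χ, h1⟩ (x := y) (by simpa using hy)
    rw [hc, Finsupp.linearCombination_single, h, sub_self]
    exact zero_mem _
  rw [S.negPart_of_not_neg h1 hy, map_zero, sub_zero, b_eq]
  by_cases h0 : χ = 0
  · subst h0
    exact Submodule.mem_sup_left (S.rootSp_zero_le hy)
  by_cases h2 : χ ∈ S.Φp
  · exact Submodule.mem_sup_right (Submodule.mem_iSup_of_mem χ (Submodule.mem_iSup_of_mem h2 hy))
  · rw [S.rootSp_eq_bot h0 h2 h1, Submodule.mem_bot] at hy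
    rw [hy]
    exact zero_mem _

lemma mem_b_of_root {χ : Module.Dual K S.h} (hχ : χ = 0 ∨ χ ∈ S.Φp) {x : g}
    (hx : x ∈ rootSp K g S.h χ) : x ∈ S.b.toSubmodule := by
  rw [b_eq]
  rcases hχ with rfl | h
  · exact Submodule.mem_sup_left (S.rootSp_zero_le hx)
  · exact Submodule.mem_sup_right (Submodule.mem_iSup_of_mem χ (Submodule.mem_iSup_of_mem h hx))

lemma b_induction (N : Submodule K g)
    (hN : ∀ χ, (χ = 0 ∨ χ ∈ S.Φp) → ∀ x ∈ rootSp K g S.h χ, x ∈ N) {x : g}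
    (hx : x ∈ S.b.toSubmodule) : x ∈ N := by
  have : S.b.toSubmodule ≤ N := by
    rw [b_eq]
    exact sup_le (fun x hx => hN 0 (Or.inl rfl) x (S.h_le_rootSp_zero hx))
      (iSup₂_le fun χ hχ x hx => hN χ (Or.inr hχ) x hx)
  exact this hx

lemma negPart_eq_zero_iff (x : g) : S.negPart x = 0 ↔ x ∈ S.b.toSubmodule := by
  constructor
  · intro h
    simpa [h] using S.sub_negPart_mem x
  · intro h
    refine S.b_induction (LinearMap.ker S.negPart) (fun χ hχ y hy => ?_) h
    refine S.negPart_of_not_neg ?_ hy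
    rcases hχ with rfl | h
    · intro h
      exact S.ne_zero_of_pos h (by simp)
    · exact S.neg_not_mem h

open scoped Classical in
/-- The extension by zero of a weight to `g`. -/
def extend (lam : Module.Dual K S.h) : g →ₗ[K] K :=
  S.glue fun χ => if h : χ = 0 then
    lam ∘ₗ Submodule.inclusion (show rootSp K g S.h χ ≤ S.h.toSubmodule by
      rw [h]; exact S.rootSp_zero_le) else 0

lemma extend_h (lam : Module.Dual K S.h) (H : S.h) : S.extend lam H = lam H := by
  rw [extend, S.glue_of_mem _ (S.h_le_rootSp_zero H.2), dif_pos rfl]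
  rfl

lemma extend_of_ne (lam : Module.Dual K S.h) {χ : Module.Dual K S.h} (hχ : χ ≠ 0) {x : g}
    (hx : x ∈ rootSp K g S.h χ) : S.extend lam x = 0 := by
  rw [extend, S.glue_of_mem _ hx, dif_neg hχ, LinearMap.zero_apply]

lemma extend_nplus (lam : Module.Dual K S.h) {x : g} (hx : x ∈ S.nplus) :
    S.extend lam x = 0 := by
  have : S.nplus ≤ LinearMap.ker (S.extend lam) :=
    iSup₂_le fun χ hχ x hx => S.extend_of_ne lam (S.ne_zero_of_pos hχ) hx
  exact this hx

lemma extend_lie (lam : Module.Dual K S.h) {x y : g} (hx : x ∈ S.b.toSubmodule)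
    (hy : y ∈ S.b.toSubmodule) : S.extend lam ⁅x, y⁆ = 0 := by
  refine S.b_induction
    (LinearMap.ker (S.extend lam ∘ₗ (LieModule.toEnd K g g).toLinearMap.flip y))
    (fun χ hχ x hx => ?_) hx
  refine S.b_induction (LinearMap.ker (S.extend lam ∘ₗ LieModule.toEnd K g g x))
    (fun ψ hψ y hy => ?_) hy
  show S.extend lam ⁅x, y⁆ = 0
  by_cases h : χ + ψ = 0
  · have h2 : χ = -ψ := eq_neg_of_add_eq_zero_left h
    have h3 : ψ = 0 := by
      by_contra h3
      rcases hψ with h4 | h4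
      · exact h3 h4
      rcases hχ with h5 | h5
      · rw [h5] at h2
        exact h3 (neg_eq_zero.mp h2.symm)
      · exact S.neg_not_mem h4 (h2 ▸ h5)
    subst h3
    rw [neg_zero] at h2
    subst h2
    rw [S.lie_h_h (S.rootSp_zero_le hx) (S.rootSp_zero_le hy), map_zero]
  · exact S.extend_of_ne lam h (lie_mem_rootSp hx hy)

end RootReductive

namespace InductionDatum

variable {L I : Type} [LieRing L] [LieAlgebra K L] [LinearOrder I]

/-- The vectors on which `ker π` acts by `χ`. -/
def singular (D : InductionDatum K L I) (χ : L →ₗ[K] K) : Submodule K (MvPolynomial I K) where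
  carrier := {p | ∀ x, D.π x = 0 → D.act x p = χ x • p}
  add_mem' := by
    intro p q hp hq x hx
    rw [map_add, hp x hx, hq x hx, smul_add]
  zero_mem' := by intro x _; simp
  smul_mem' := by
    intro c p hp x hx
    rw [map_smul, hp x hx, smul_comm]

lemma ideal_le_ker (D D' : InductionDatum K L I) (hπ : ∀ x, D'.π x = 0 → D.π x = 0)
    {p : MvPolynomial I K} (hp : p ∈ D.singular D'.χ) :
    D'.ideal ≤ LinearMap.ker (LinearMap.toSpanSingleton (UEA K L) (UEA K L ⧸ D.ideal)
      (D.ofPoly p)) := by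
  rw [ideal, Submodule.span_le]
  rintro _ ⟨x, hx, rfl⟩
  show (ι K x - algebraMap K (UEA K L) (D'.χ x)) • D.ofPoly p = 0
  rw [sub_smul, algebraMap_smul, ← D.ofPoly_toEnd, D.toEnd_ι, hp x (hπ x hx), map_smul, sub_self]

lemma nonempty_singular_equiv (D D' : InductionDatum K L I)
    (hπ : ∀ x, D'.π x = 0 ↔ D.π x = 0) (J J' : Submodule (UEA K L) (UEA K L))
    (hJ : J = D.ideal) (hJ' : J' = D'.ideal) :
    let _ := homKModule K L (UEA K L ⧸ J') (UEA K L ⧸ J)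
    Nonempty (D.singular D'.χ ≃ₗ[K] ((UEA K L ⧸ J') →ₗ[UEA K L] (UEA K L ⧸ J))) := by
  subst hJ hJ'
  intro _inst
  let T : D.singular D'.χ →ₗ[K] ((UEA K L ⧸ D'.ideal) →ₗ[UEA K L] (UEA K L ⧸ D.ideal)) :=
    { toFun := fun p => D'.ideal.liftQ _ (ideal_le_ker D D' (fun x => (hπ x).mp) p.2)
      map_add' := by
        intro p q
        refine Submodule.linearMap_qext _ (LinearMap.ext fun u => ?_)
        show u • D.ofPoly (p.1 + q.1) = u • D.ofPoly p.1 + u • D.ofPoly q.1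
        rw [map_add, smul_add]
      map_smul' := by
        intro c p
        refine Submodule.linearMap_qext _ (LinearMap.ext fun u => ?_)
        show u • D.ofPoly (c • p.1) = algebraMap K (UEA K L) c • (u • D.ofPoly p.1)
        rw [map_smul, algebraMap_smul, smul_comm] }
  refine ⟨LinearEquiv.ofBijective T ⟨?_, fun f => ?_⟩⟩
  · rw [injective_iff_map_eq_zero]
    intro p hp
    have : T p (Submodule.Quotient.mk 1) = 0 := by rw [hp]; rfl
    have h1 : (1 : UEA K L) • D.ofPoly p.1 = 0 := this
    rw [one_smul, ← map_zero D.ofPoly] at h1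
    exact Subtype.ext (D.ofPoly_bijective.1 h1)
  · obtain ⟨p, hp⟩ := D.ofPoly_bijective.2 (f (Submodule.Quotient.mk 1))
    have hmem : p ∈ D.singular D'.χ := by
      intro x hx
      have h1 : (ι K x - algebraMap K (UEA K L) (D'.χ x)) ∈ D'.ideal :=
        Submodule.subset_span ⟨x, (hπ x).mpr hx, rfl⟩
      have h2 : (ι K x - algebraMap K (UEA K L) (D'.χ x)) •
          f (Submodule.Quotient.mk 1) = 0 := by
        rw [← map_smul, ← Submodule.Quotient.mk_smul, smul_eq_mul, mul_one,
          (Submodule.Quotient.mk_eq_zero _).mpr h1, map_zero]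
      rw [← hp, sub_smul, algebraMap_smul, sub_eq_zero, ← D.ofPoly_toEnd, D.toEnd_ι,
        ← map_smul] at h2
      exact D.ofPoly_bijective.1 h2
    refine ⟨⟨p, hmem⟩, Submodule.linearMap_qext _ (LinearMap.ext fun u => ?_)⟩
    show u • D.ofPoly p = f (Submodule.Quotient.mk u)
    rw [hp, ← map_smul, ← Submodule.Quotient.mk_smul, smul_eq_mul, mul_one]

end InductionDatum

namespace RootReductive

variable (S : RootReductive K g)

open scoped Classical in
instance : LinearOrder S.Φp := linearOrderOfSTO WellOrderingRel

/-- The induction datum of a Verma module. -/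
def datum (lam : Module.Dual K S.h) : InductionDatum K g S.Φp where
  f := S.negVec
  π := S.negPart
  χ := S.extend lam
  π_f := S.negPart_negVec
  χ_f α := S.extend_of_ne lam (neg_ne_zero.mpr (S.ne_zero_of_pos α.2)) (S.negVec_mem α)
  π_lie x y hx hy := (S.negPart_eq_zero_iff _).mpr
    (S.b.lie_mem ((S.negPart_eq_zero_iff x).mp hx) ((S.negPart_eq_zero_iff y).mp hy))
  χ_lie x y hx hy :=
    S.extend_lie lam ((S.negPart_eq_zero_iff x).mp hx) ((S.negPart_eq_zero_iff y).mp hy)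

lemma vIdeal_eq (lam : Module.Dual K S.h) : S.vIdeal lam = (S.datum lam).ideal := by
  apply le_antisymm
  · rw [vIdeal, Submodule.span_le]
    rintro _ (⟨x, hx, rfl⟩ | ⟨H, rfl⟩)
    · refine Submodule.subset_span ⟨x, (S.negPart_eq_zero_iff x).mpr ?_, ?_⟩
      · rw [b_eq]
        exact Submodule.mem_sup_right hx
      · show _ = _ - algebraMap K _ (S.extend lam x)
        rw [S.extend_nplus lam hx, map_zero, sub_zero]
    · refine Submodule.subset_span ⟨H, (S.negPart_eq_zero_iff H).mpr (S.h_le_b H.2), ?_⟩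
      show _ = _ - algebraMap K _ (S.extend lam H)
      rw [extend_h]
  · rw [InductionDatum.ideal, Submodule.span_le]
    rintro _ ⟨x, hx, rfl⟩
    have hx' := (S.negPart_eq_zero_iff x).mp hx
    rw [b_eq] at hx'
    obtain ⟨H, hH, y, hy, rfl⟩ := Submodule.mem_sup.mp hx'
    show _ - algebraMap K _ (S.extend lam (H + y)) ∈ S.vIdeal lam
    rw [map_add, map_add, S.extend_nplus lam hy, S.extend_h lam ⟨H, hH⟩, add_zero,
      add_sub_right_comm]
    exact add_mem (Submodule.subset_span (Or.inr ⟨⟨H, hH⟩, rfl⟩))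
      (Submodule.subset_span (Or.inl ⟨y, hy, rfl⟩))

section Sub

variable (a : LieSubalgebra K g)

/-- The positive roots whose negative root space lies in a subalgebra. -/
def negIn : Set S.Φp := {α | rootSp K g S.h (-α.1) ≤ a.toSubmodule}

lemma negPart_apply_eq_zero (ha : S.h ≤ a) {x : g} (hx : x ∈ a) {α : S.Φp} (hα : α ∉ S.negIn a) :
    S.negPart x α = 0 := by
  obtain ⟨F, y, hy, hs⟩ := S.exists_components x
  have hmem := component_mem a.toSubmodule (fun H x hx => a.lie_mem (ha H.2) hx) F y
    (fun χ _ => hy χ) (by rw [hs]; exact hx)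
  rw [← hs, map_sum, Finsupp.finsetSum_apply]
  refine Finset.sum_eq_zero fun χ hχ => ?_
  by_cases h1 : -χ ∈ S.Φp
  · obtain ⟨c, hc, h⟩ := S.negPart_of_neg ⟨-χ, h1⟩ (x := y χ) (by simpa using hy χ)
    rw [hc]
    by_cases h2 : (⟨-χ, h1⟩ : S.Φp) = α
    · by_cases h3 : c = 0
      · simp [h3]
      · exfalso
        apply hα
        subst h2
        intro z hz
        have h4 : y χ ≠ 0 := by
          rw [← h]
          exact smul_ne_zero h3 (S.negVec_ne_zero _)
        simp only [neg_neg] at hz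
        obtain ⟨d, rfl⟩ := S.rootSp_eq_span (by simpa using S.neg_mem h1) (hy χ) h4 hz
        exact a.toSubmodule.smul_mem d (hmem χ hχ)
    · exact Finsupp.single_eq_of_ne' h2
  · rw [S.negPart_of_not_neg h1 (hy χ)]
    rfl

/-- The coordinates in the negative root spaces contained in a subalgebra. -/
def subNegPart : a →ₗ[K] (S.negIn a →₀ K) :=
  Finsupp.lsubtypeDomain (S.negIn a) ∘ₗ S.negPart ∘ₗ a.toSubmodule.subtype

lemma subNegPart_eq_zero_iff (ha : S.h ≤ a) (x : a) : S.subNegPart a x = 0 ↔ S.negPart (x : g) = 0 := by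
  constructor
  · intro h
    ext α
    by_cases hα : α ∈ S.negIn a
    · exact DFunLike.congr_fun h (⟨α, hα⟩ : S.negIn a)
    · exact S.negPart_apply_eq_zero a ha x.2 hα
  · intro h
    ext α
    exact DFunLike.congr_fun h α.1

variable (ha : S.h ≤ a)

/-- The induction datum of a Verma module of a subalgebra. -/
def subDatum (lam : Module.Dual K S.h) : InductionDatum K a (S.negIn a) where
  f α := ⟨S.negVec α, α.2 (S.negVec_mem α)⟩
  π := S.subNegPart a
  χ := S.extend lam ∘ₗ a.toSubmodule.subtype
  π_f α := by
    ext β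
    show S.negPart (S.negVec α) β.1 = _
    rw [negPart_negVec]
    by_cases h : α = β
    · rw [h, Finsupp.single_eq_same, Finsupp.single_eq_same]
    · rw [Finsupp.single_eq_of_ne' h, Finsupp.single_eq_of_ne' (Subtype.coe_ne_coe.mpr h)]
  χ_f α := (S.datum lam).χ_f α
  π_lie x y hx hy := (S.subNegPart_eq_zero_iff a ha _).mpr ((S.datum lam).π_lie x y
    ((S.subNegPart_eq_zero_iff a ha x).mp hx) ((S.subNegPart_eq_zero_iff a ha y).mp hy))
  χ_lie x y hx hy := (S.datum lam).χ_lie x y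
    ((S.subNegPart_eq_zero_iff a ha x).mp hx) ((S.subNegPart_eq_zero_iff a ha y).mp hy)

lemma vIdealSub_eq (lam : Module.Dual K S.h) :
    S.vIdealSub a ha lam = (S.subDatum a ha lam).ideal := by
  apply le_antisymm
  · rw [vIdealSub, Submodule.span_le]
    rintro _ (⟨x, hx, rfl⟩ | ⟨H, rfl⟩)
    · refine Submodule.subset_span ⟨x, (S.subNegPart_eq_zero_iff a ha x).mpr
        ((S.negPart_eq_zero_iff x.1).mpr ?_), ?_⟩
      · rw [b_eq]
        exact Submodule.mem_sup_right hx
      · show _ = _ - algebraMap K _ (S.extend lam x)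
        rw [S.extend_nplus lam hx, map_zero, sub_zero]
    · refine Submodule.subset_span ⟨⟨H, ha H.2⟩, (S.subNegPart_eq_zero_iff a ha _).mpr
        ((S.negPart_eq_zero_iff H.1).mpr (S.h_le_b H.2)), ?_⟩
      show _ = _ - algebraMap K _ (S.extend lam H)
      rw [extend_h]
  · rw [InductionDatum.ideal, Submodule.span_le]
    rintro _ ⟨⟨x, hxa⟩, hx, rfl⟩
    have hx' := (S.negPart_eq_zero_iff x).mp ((S.subNegPart_eq_zero_iff a ha _).mp hx)
    rw [b_eq] at hx'
    obtain ⟨H, hH, y, hy, rfl⟩ := Submodule.mem_sup.mp hx'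
    have hya : y ∈ a := by simpa using a.sub_mem hxa (ha hH)
    have h1 : (⟨H + y, hxa⟩ : a) = ⟨H, ha hH⟩ + ⟨y, hya⟩ := rfl
    show _ - algebraMap K _ (S.extend lam (H + y)) ∈ S.vIdealSub a ha lam
    rw [h1, map_add, map_add, S.extend_nplus lam hy, S.extend_h lam ⟨H, hH⟩, add_zero,
      add_sub_right_comm]
    exact add_mem (Submodule.subset_span (Or.inr ⟨⟨H, hH⟩, rfl⟩))
      (Submodule.subset_span (Or.inl ⟨⟨y, hya⟩, hy, rfl⟩))

lemma compatible (lam : Module.Dual K S.h) :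
    InductionDatum.Compatible (S.datum lam) (S.subDatum a ha lam) a.incl
      (OrderEmbedding.subtype (· ∈ S.negIn a)) where
  f _ := rfl
  π x hx := (S.subNegPart_eq_zero_iff a ha x).mp hx
  χ _ _ := rfl

end Sub

end RootReductive

section

variable {V : Type*} [AddCommGroup V] [Module K V] [FiniteDimensional K V]

/-- An endomorphism commuting with `E` and `F`, whose commutator it is, has only the eigenvalue
zero. -/
lemma eigenvalue_eq_zero_of_commutator {E F Z : Module.End K V} (hZ : Z = E * F - F * E)
    (hE : Commute Z E) (hF : Commute Z F) {c : K} {v : V} (hv : Z v = c • v) (hv0 : v ≠ 0) :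
    c = 0 := by
  let W := Module.End.eigenspace Z c
  have hW : ∀ T : Module.End K V, Commute Z T → ∀ w ∈ W, T w ∈ W := fun T hT w hw => by
    rw [Module.End.mem_eigenspace_iff] at hw ⊢
    rw [← Module.End.mul_apply, hT.eq, Module.End.mul_apply, hw, map_smul]
  have h1 : E.restrict (hW E hE) * F.restrict (hW F hF) -
      F.restrict (hW F hF) * E.restrict (hW E hE) = c • (1 : Module.End K W) := by
    ext w
    have := Module.End.mem_eigenspace_iff.mp w.2
    rw [hZ] at this
    exact this
  have h2 := congrArg (LinearMap.trace K W) h1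
  rw [map_sub, LinearMap.trace_mul_comm, sub_self, map_smul, LinearMap.trace_one, smul_eq_mul,
    eq_comm, mul_eq_zero] at h2
  refine h2.resolve_right fun h3 => hv0 ?_
  have h4 : W = ⊥ := Submodule.finrank_eq_zero.mp (by exact_mod_cast h3)
  exact (Submodule.mem_bot K).mp (h4 ▸ Module.End.mem_eigenspace_iff.mpr hv)

end

namespace RootReductive

attribute [local instance] LieRing.ofAssociativeRing

variable (S : RootReductive K g)

lemma gc_induction {n : ℕ} (N : Submodule K (S.gc n)) (h0 : ∀ x : S.gc n, (x : g) ∈ S.h → x ∈ N)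
    (h1 : ∀ α ∈ S.Φ, ∀ x : S.gc n, (x : g) ∈ rootSp K g S.h α → x ∈ N) (x : S.gc n) : x ∈ N := by
  have h : (S.gc n).toSubmodule ≤ N.map (S.gc n).toSubmodule.subtype := by
    nth_rw 1 [S.gc_rootdec n]
    refine sup_le ?_ (iSup₂_le fun α hα => ?_)
    · rintro x ⟨hx, hx'⟩
      exact ⟨⟨x, hx⟩, h0 _ hx', rfl⟩
    · rintro x ⟨hx, hx'⟩
      exact ⟨⟨x, hx⟩, h1 α hα _ hx', rfl⟩
  obtain ⟨y, hy, hyx⟩ := h x.2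
  rwa [← Subtype.ext hyx]

lemma mem_h_of_forall_lie {n : ℕ} {z : S.gc n} (hz : ∀ x : S.gc n, (x : g) ∈ S.h → ⁅z, x⁆ = 0) :
    (z : g) ∈ S.h := by
  obtain ⟨hc, hch, hcc⟩ := S.gc_cartan n
  have hmem : ∀ x : S.gc n, x ∈ hc ↔ (x : g) ∈ S.h := fun x => Set.ext_iff.mp hch x
  rw [← hmem, ← hcc.self_normalizing, LieSubalgebra.mem_normalizer_iff]
  intro x hx
  rw [hz x ((hmem x).mp hx)]
  exact zero_mem hc

lemma exists_sl2 {α : Module.Dual K S.h} (hα : α ∈ S.Φ) :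
    ∃ e ∈ rootSp K g S.h α, ∃ f ∈ rootSp K g S.h (-α), ∃ z : S.h, ⁅e, f⁆ = z ∧ α z = 2 := by
  obtain ⟨e₀, he₀, he0⟩ := S.exists_ne_zero hα
  obtain ⟨H₀, hH₀⟩ : ∃ H, α H ≠ 0 := by
    by_contra! h
    exact ((S.root_iff α).mp hα).1 (LinearMap.ext h)
  obtain ⟨n₁, hn₁⟩ := S.gc_exhausts e₀
  obtain ⟨n₂, hn₂⟩ := S.gc_exhausts H₀
  obtain ⟨n, e, H, rfl, hH⟩ : ∃ n, ∃ e H : S.gc n, (e : g) = e₀ ∧ (H : g) = H₀ :=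
    ⟨max n₁ n₂, ⟨e₀, S.gc_mono (le_max_left _ _) hn₁⟩, ⟨H₀, S.gc_mono (le_max_right _ _) hn₂⟩,
      rfl, rfl⟩
  have := S.gc_findim n
  have wt : ∀ {β : Module.Dual K S.h} {x y : S.gc n} (hx : (x : g) ∈ S.h),
      (y : g) ∈ rootSp K g S.h β → ⁅x, y⁆ = β ⟨x, hx⟩ • y := fun hx hy => Subtype.ext (hy ⟨_, hx⟩)
  have hHh : (H : g) ∈ S.h := hH ▸ H₀.2
  have hHα : α ⟨H, hHh⟩ ≠ 0 := by convert hH₀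
  have hHe : ⁅H, e⁆ = α ⟨H, hHh⟩ • e := wt hHh he₀
  have he0' : e ≠ 0 := fun h => he0 (by rw [h]; rfl)
  have inv := LieModule.traceForm_apply_lie_apply K (S.gc n) (S.gc n)
  have inv' := LieModule.traceForm_apply_lie_apply' K (S.gc n) (S.gc n)
  have comm := LieModule.traceForm_comm K (S.gc n) (S.gc n)
  obtain ⟨y₀, hy₀⟩ : ∃ y, killingForm K (S.gc n) e y ≠ 0 := by
    by_contra! h
    have h1 : e ∈ LieIdeal.killingCompl K (S.gc n) ⊤ := by
      rw [LieIdeal.mem_killingCompl]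
      intro y _
      rw [LieModule.traceForm_comm]
      exact h y
    have h2 := LieAlgebra.killingCompl_top_le_radical K (S.gc n) h1
    rw [S.gc_reductive] at h2
    have h3 : ⁅H, e⁆ = 0 := (LieModule.mem_maxTrivSubmodule K (S.gc n) (S.gc n) e).mp h2 H
    rw [hHe, smul_eq_zero] at h3
    exact h3.elim hHα he0'
  have hh : ∀ x : S.gc n, (x : g) ∈ S.h → killingForm K (S.gc n) e x = 0 := by
    intro x hx
    have h1 : ⁅H, x⁆ = 0 := Subtype.ext (S.lie_h_h hHh hx)
    have h2 := inv' H e x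
    rw [hHe, h1, map_zero, neg_zero, map_smul, LinearMap.smul_apply, smul_eq_mul] at h2
    exact (mul_eq_zero.mp h2).resolve_left hHα
  obtain ⟨β, hβ, y, hy, hey⟩ : ∃ β ∈ S.Φ, ∃ y : S.gc n, (y : g) ∈ rootSp K g S.h β ∧
      killingForm K (S.gc n) e y ≠ 0 := by
    by_contra! h
    exact hy₀ (S.gc_induction (LinearMap.ker (killingForm K (S.gc n) e)) hh h y₀)
  have hsum : ∀ x : S.gc n, ∀ hx : (x : g) ∈ S.h, (α + β) ⟨x, hx⟩ = 0 := by
    intro x hx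
    have h2 := inv' x e y
    rw [wt hx he₀, wt hx hy, map_smul, map_smul, LinearMap.smul_apply, smul_eq_mul, smul_eq_mul,
      eq_neg_iff_add_eq_zero, ← add_mul] at h2
    exact (mul_eq_zero.mp h2).resolve_right hey
  have hz := lie_mem_rootSp he₀ hy
  have hκ : killingForm K (S.gc n) H ⁅e, y⁆ ≠ 0 := by
    rw [← inv, hHe, map_smul, LinearMap.smul_apply, smul_eq_mul]
    exact mul_ne_zero hHα hey
  have hz0 : (⁅(e : g), (y : g)⁆) ≠ 0 := fun h => hκ (by
    rw [show ⁅e, y⁆ = 0 from Subtype.ext h, map_zero])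
  have hzh : ⁅(e : g), (y : g)⁆ ∈ S.h := by
    refine S.mem_h_of_forall_lie (z := ⁅e, y⁆) fun x hx => ?_
    rw [← lie_skew, wt hx (y := ⁅e, y⁆) hz, hsum x hx, zero_smul, neg_zero]
  have hβα : β = -α := by
    refine eq_neg_of_add_eq_zero_right (LinearMap.ext fun x => ?_)
    have h1 := hz x
    rw [S.lie_h_h x.2 hzh, eq_comm, smul_eq_zero] at h1
    exact h1.resolve_right hz0
  subst hβα
  set z : S.gc n := ⁅e, y⁆ with hzdef
  have hαz : α ⟨z, hzh⟩ ≠ 0 := by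
    intro h0
    have hE : ⁅z, e⁆ = 0 := by rw [wt hzh he₀, h0, zero_smul]
    have hF : ⁅z, y⁆ = 0 := by rw [wt hzh hy, LinearMap.neg_apply, h0, neg_zero, zero_smul]
    have hcomm : ∀ u v : S.gc n, LieAlgebra.ad K (S.gc n) ⁅u, v⁆ =
        LieAlgebra.ad K _ u * LieAlgebra.ad K _ v - LieAlgebra.ad K _ v * LieAlgebra.ad K _ u :=
      fun u v => by rw [LieHom.map_lie, LieRing.of_associative_ring_bracket]
    have hcom : ∀ u, ⁅z, u⁆ = 0 → Commute (LieAlgebra.ad K (S.gc n) z) (LieAlgebra.ad K _ u) :=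
      fun u hu => by
        have := hcomm z u
        rw [hu, map_zero, eq_comm, sub_eq_zero] at this
        exact this
    have hzero : ∀ x, x ∈ LinearMap.ker (LieAlgebra.ad K (S.gc n) z) := by
      refine S.gc_induction _ (fun x hx => Subtype.ext (S.lie_h_h hzh hx)) fun γ hγ x hx => ?_
      by_cases hx0 : x = 0
      · rw [hx0]
        exact zero_mem _
      · have := eigenvalue_eq_zero_of_commutator (hcomm e y) (hcom e hE) (hcom y hF)
          (wt hzh hx) hx0
        rw [LinearMap.mem_ker, LieAlgebra.ad_apply, wt hzh hx, this, zero_smul]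
    apply hκ
    rw [killingForm_apply_apply, LinearMap.ext (g := 0) (fun x => hzero x), LinearMap.comp_zero,
      map_zero]
  refine ⟨e, he₀, (2 / α ⟨z, hzh⟩) • (y : g), Submodule.smul_mem _ _ hy,
    (2 / α ⟨z, hzh⟩) • ⟨z, hzh⟩, ?_, ?_⟩
  · rw [lie_smul]
    rfl
  · rw [map_smul, smul_eq_mul, div_mul_cancel₀ _ hαz]

end RootReductive

namespace IsSl2Triple

open LieModule

variable {L M : Type*} [LieRing L] [LieAlgebra K L] [AddCommGroup M] [Module K M]
  [LieRingModule L M] [LieModule K L M] [FiniteDimensional K M] {h e f : L}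

/-- A nonzero vector of positive weight `m + 2` is not annihilated by going to the top of its
string and coming back to weight `m`; the resulting vector is not annihilated by `e`. -/
lemma exists_lie_pow_ne_zero (t : IsSl2Triple h e f) {m : ℕ} {w : M} (hw0 : w ≠ 0)
    (hw : ⁅h, w⁆ = ((m : K) + 2) • w) :
    ∃ k, ⁅e, (toEnd K L M f ^ (k + 1)) ((toEnd K L M e ^ k) w)⁆ ≠ 0 := by
  have hex : ∃ k, (toEnd K L M e ^ k) w = 0 := by
    by_contra! hne
    have hinj : Function.Injective fun n : ℕ => (m : K) + 2 + 2 * n := fun a b hab => by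
      simpa using hab
    have := Module.End.eigenvectors_linearIndependent' (toEnd K L M h) _ hinj
      (fun n => (toEnd K L M e ^ n) w) fun n => Module.End.hasEigenvector_iff.mpr
        ⟨Module.End.mem_eigenspace_iff.mpr (t.lie_h_pow_toEnd_e hw n), hne n⟩
    exact not_finite_iff_infinite.mpr inferInstance (this.finite : Finite ℕ)
  obtain ⟨k, hk, hk'⟩ := Nat.exists_not_and_succ_of_not_zero_of_exists (p := fun k =>
    (toEnd K L M e ^ k) w = 0) (by simpa using hw0) hex
  have P : HasPrimitiveVectorWith t ((toEnd K L M e ^ k) w) (((m + 2 + 2 * k : ℕ)) : K) :=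
    { ne_zero := hk
      lie_h := by
        rw [t.lie_h_pow_toEnd_e hw k]
        push_cast
        rfl
      lie_e := by rwa [lie_e_pow_toEnd_e] }
  refine ⟨k, ?_⟩
  rw [P.lie_e_pow_succ_toEnd_f]
  refine smul_ne_zero (mul_ne_zero (Nat.cast_add_one_ne_zero k) ?_)
    (P.pow_toEnd_f_ne_zero_of_eq_nat rfl (by omega))
  rw [sub_ne_zero]
  exact fun h => absurd (Nat.cast_injective h) (by omega)

end IsSl2Triple

namespace RootReductive

variable (S : RootReductive K g)

/-- Root vectors for `α` and `-α` whose bracket `z` satisfies `α z = 2`. -/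
structure IsRootTriple (α : Module.Dual K S.h) (e f : g) (z : S.h) : Prop where
  e_mem : e ∈ rootSp K g S.h α
  f_mem : f ∈ rootSp K g S.h (-α)
  lie_eq : ⁅e, f⁆ = z
  apply_eq : α z = 2

namespace IsRootTriple

variable {S} {α β : Module.Dual K S.h} {e f : g} {z : S.h}

lemma symm (t : S.IsRootTriple α e f z) : S.IsRootTriple (-α) f e (-z) where
  e_mem := t.f_mem
  f_mem := by simpa using t.e_mem
  lie_eq := by rw [← lie_skew, t.lie_eq]; rfl
  apply_eq := by simpa using t.apply_eq

lemma toSl2 (t : S.IsRootTriple α e f z) {n : ℕ} (he : e ∈ S.gc n) (hf : f ∈ S.gc n) :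
    IsSl2Triple (L := S.gc n) ⁅(⟨e, he⟩ : S.gc n), (⟨f, hf⟩ : S.gc n)⁆ ⟨e, he⟩ ⟨f, hf⟩ where
  h_ne_zero h := by
    have h1 : z = 0 := Subtype.ext (t.lie_eq.symm.trans (congrArg Subtype.val h))
    have := t.apply_eq
    rw [h1, map_zero] at this
    exact two_ne_zero this.symm
  lie_e_f := rfl
  lie_h_e_nsmul := Subtype.ext (by
    show ⁅⁅e, f⁆, e⁆ = 2 • e
    rw [t.lie_eq, t.e_mem z, t.apply_eq, two_smul, two_nsmul])
  lie_h_f_nsmul := Subtype.ext (by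
    show ⁅⁅e, f⁆, f⁆ = -(2 • f)
    rw [t.lie_eq, t.f_mem z, LinearMap.neg_apply, t.apply_eq, neg_smul, two_smul, two_nsmul])

lemma exists_level (e f y : g) : ∃ n, e ∈ S.gc n ∧ f ∈ S.gc n ∧ y ∈ S.gc n := by
  obtain ⟨n₁, h₁⟩ := S.gc_exhausts e
  obtain ⟨n₂, h₂⟩ := S.gc_exhausts f
  obtain ⟨n₃, h₃⟩ := S.gc_exhausts y
  exact ⟨max n₁ (max n₂ n₃), S.gc_mono (by simp) h₁, S.gc_mono (by simp) h₂,
    S.gc_mono (by simp) h₃⟩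

lemma exists_nat_of_lie_eq_zero (t : S.IsRootTriple α e f z) {y : g}
    (hy : y ∈ rootSp K g S.h β) (hy0 : y ≠ 0) (hey : ⁅e, y⁆ = 0) : ∃ n : ℕ, β z = n := by
  obtain ⟨n, he, hf, hyn⟩ := exists_level (S := S) e f y
  have := S.gc_findim n
  have P : IsSl2Triple.HasPrimitiveVectorWith (t.toSl2 he hf) (⟨y, hyn⟩ : S.gc n) (β z) :=
    { ne_zero := fun h => hy0 (congrArg Subtype.val h)
      lie_h := Subtype.ext (by
        show ⁅⁅e, f⁆, y⁆ = β z • y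
        rw [t.lie_eq, hy z])
      lie_e := Subtype.ext hey }
  exact P.exists_nat

lemma exists_nat (t : S.IsRootTriple α e f z) (hβ : β ∈ S.Φ) (h0 : β + α ≠ 0) (h : β + α ∉ S.Φ) :
    ∃ n : ℕ, β z = n := by
  obtain ⟨y, hy, hy0⟩ := S.exists_ne_zero hβ
  refine t.exists_nat_of_lie_eq_zero hy hy0 ?_
  have h1 := lie_mem_rootSp t.e_mem hy
  have h2 : rootSp K g S.h (α + β) = ⊥ := by
    by_contra h2
    rw [add_comm] at h2
    exact h ((S.root_iff _).mpr ⟨h0, h2⟩)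
  rwa [h2, Submodule.mem_bot] at h1

end IsRootTriple

lemma exists_isRootTriple {α : Module.Dual K S.h} (hα : α ∈ S.Φ) :
    ∃ e f z, S.IsRootTriple α e f z := by
  obtain ⟨e, he, f, hf, z, h1, h2⟩ := S.exists_sl2 hα
  exact ⟨e, f, z, he, hf, h1, h2⟩

lemma toEnd_pow_mem {n : ℕ} {α : Module.Dual K S.h} {x : S.gc n}
    (hx : (x : g) ∈ rootSp K g S.h α) (k : ℕ) :
    ∀ {β : Module.Dual K S.h} {y : S.gc n}, (y : g) ∈ rootSp K g S.h β →
      (((LieModule.toEnd K (S.gc n) (S.gc n) x ^ k) y : S.gc n) : g) ∈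
        rootSp K g S.h (k • α + β) := by
  induction k with
  | zero => intro β y hy; simpa using hy
  | succ k ih =>
    intro β y hy
    rw [pow_succ, Module.End.mul_apply, succ_nsmul, add_assoc]
    exact ih (lie_mem_rootSp hx hy)

lemma lie_ne_zero {α β : Module.Dual K S.h} (hα : α ∈ S.Φ) (hβ : β ∈ S.Φ) (hαβ : α + β ∈ S.Φ)
    {x y : g} (hx : x ∈ rootSp K g S.h α) (hy : y ∈ rootSp K g S.h β) (hx0 : x ≠ 0)
    (hy0 : y ≠ 0) : ⁅x, y⁆ ≠ 0 := by
  intro hxy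
  obtain ⟨e, f, z, t⟩ := S.exists_isRootTriple hα
  have hey : ⁅e, y⁆ = 0 := by
    obtain ⟨c, rfl⟩ := S.rootSp_eq_span hα hx hx0 t.e_mem
    rw [smul_lie, hxy, smul_zero]
  obtain ⟨m, hm⟩ := t.exists_nat_of_lie_eq_zero hy hy0 hey
  obtain ⟨w, hw, hw0⟩ := S.exists_ne_zero hαβ
  obtain ⟨n, he, hf, hwn⟩ := IsRootTriple.exists_level (S := S) e f w
  have := S.gc_findim n
  obtain ⟨k, hk⟩ := (t.toSl2 he hf).exists_lie_pow_ne_zero (K := K) (m := m)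
    (w := (⟨w, hwn⟩ : S.gc n)) (fun h => hw0 (congrArg Subtype.val h)) (Subtype.ext (by
      show ⁅⁅e, f⁆, w⁆ = _ • w
      rw [t.lie_eq, hw z, LinearMap.add_apply, hm, t.apply_eq, add_comm]))
  have h1 := S.toEnd_pow_mem (x := ⟨f, hf⟩) t.f_mem (k + 1)
    (S.toEnd_pow_mem (x := ⟨e, he⟩) t.e_mem k (y := ⟨w, hwn⟩) hw)
  rw [show (k + 1) • -α + (k • α + (α + β)) = β by
    rw [← add_assoc, ← add_assoc, smul_neg, add_assoc, add_assoc, ← add_assoc (k • α),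
      ← succ_nsmul, neg_add_cancel_left]] at h1
  obtain ⟨c, hc⟩ := S.rootSp_eq_span hβ hy hy0 h1
  refine hk (Subtype.ext ?_)
  rw [LieSubalgebra.coe_bracket, ← hc, lie_smul, hey, smul_zero]
  rfl

end RootReductive

namespace RootReductive

variable (S : RootReductive K g)

lemma IsRootTriple.exists_mem_add_mem {S : RootReductive K g} {α : Module.Dual K S.h} {e f : g}
    {z : S.h} (t : S.IsRootTriple α e f z) {D : Multiset (Module.Dual K S.h)}
    (hD : ∀ β ∈ D, β ∈ S.Φ) (h : ¬ ∃ n : ℕ, D.sum z = n) :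
    ∃ β ∈ D, β + α = 0 ∨ β + α ∈ S.Φ := by
  by_contra! hc
  apply h
  induction D using Multiset.induction_on with
  | empty => exact ⟨0, by simp⟩
  | cons β D ih =>
    obtain ⟨n, hn⟩ := t.exists_nat (hD β (Multiset.mem_cons_self _ _))
      (hc β (Multiset.mem_cons_self _ _)).1 (hc β (Multiset.mem_cons_self _ _)).2
    have hih : ∃ n : ℕ, D.sum z = n := by
      by_contra h'
      exact h' (ih (fun γ hγ => hD γ (Multiset.mem_cons_of_mem hγ)) h'
        fun γ hγ => hc γ (Multiset.mem_cons_of_mem hγ))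
    obtain ⟨m, hm⟩ := hih
    exact ⟨n + m, by rw [Multiset.sum_cons, LinearMap.add_apply, hn, hm, Nat.cast_add]⟩

lemma neg_ofNat_ne_cast {m n : ℕ} : (-((m : K) + 2)) ≠ n := fun h => by
  have h1 : ((n + m + 2 : ℕ) : K) = 0 := by
    push_cast
    rw [← h]
    ring
  exact absurd (Nat.cast_eq_zero.mp h1) (by omega)

lemma neg_two_ne_cast {n : ℕ} : (-2 : K) ≠ n := by
  simpa using neg_ofNat_ne_cast (K := K) (m := 0) (n := n)

/-- A sum of positive roots containing `δ` which vanishes contains a root that can be added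
to `δ`. -/
lemma exists_add_mem_of_sum_eq_zero {δ : Module.Dual K S.h} (hδ : δ ∈ S.Φp)
    {D : Multiset (Module.Dual K S.h)} (hD : ∀ β ∈ D, β ∈ S.Φp) (h : δ + D.sum = 0) :
    ∃ β ∈ D, β + δ ∈ S.Φp := by
  obtain ⟨e, f, z, t⟩ := S.exists_isRootTriple (S.pos_subset hδ)
  obtain ⟨β, hβ, h1⟩ := t.exists_mem_add_mem (D := D) (fun β hβ => S.pos_subset (hD β hβ)) (by
    rintro ⟨n, hn⟩
    rw [← neg_eq_of_add_eq_zero_right h, LinearMap.neg_apply, t.apply_eq] at hn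
    exact neg_two_ne_cast hn)
  refine ⟨β, hβ, ?_⟩
  rcases h1 with h1 | h1
  · rw [eq_neg_of_add_eq_zero_left h1] at hβ
    exact absurd (hD _ hβ) (S.neg_not_mem hδ)
  · exact S.pos_add β (hD β hβ) δ hδ h1

lemma eq_zero_of_sum_eq_zero (n : ℕ) : ∀ D : Multiset (Module.Dual K S.h), D.card = n →
    (∀ β ∈ D, β ∈ S.Φp) → D.sum = 0 → D = 0 := by
  induction n with
  | zero => exact fun D hD _ _ => Multiset.card_eq_zero.mp hD
  | succ n ih =>
    intro D hn hD h
    obtain ⟨δ, D, rfl⟩ : ∃ δ D', D = δ ::ₘ D' := by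
      obtain ⟨δ, hδ⟩ := Multiset.card_pos_iff_exists_mem.mp (by rw [hn]; exact n.succ_pos)
      exact ⟨δ, Multiset.exists_cons_of_mem hδ⟩
    have hδ := hD δ (Multiset.mem_cons_self _ _)
    obtain ⟨β, hβ, h1⟩ := S.exists_add_mem_of_sum_eq_zero hδ
      (fun β hβ => hD β (Multiset.mem_cons_of_mem hβ)) (by rwa [← Multiset.sum_cons])
    obtain ⟨D, rfl⟩ := Multiset.exists_cons_of_mem hβ
    refine absurd (ih ((β + δ) ::ₘ D) ?_ ?_ ?_) (Multiset.cons_ne_zero)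
    · simpa using hn
    · intro γ hγ
      rcases Multiset.mem_cons.mp hγ with rfl | hγ
      · exact h1
      · exact hD γ (Multiset.mem_cons_of_mem (Multiset.mem_cons_of_mem hγ))
    · rw [← h, Multiset.sum_cons, Multiset.sum_cons, Multiset.sum_cons]
      abel

lemma exists_multiset {a : Module.Dual K S.h} {A : Set (Module.Dual K S.h)}
    (ha : a ∈ AddSubmonoid.closure A) :
    ∃ D : Multiset (Module.Dual K S.h), (∀ β ∈ D, β ∈ A) ∧ D.sum = a :=
  AddSubmonoid.exists_multiset_of_mem_closure ha

lemma eq_zero_of_add_eq_zero {a b : Module.Dual K S.h} (ha : a ∈ S.Γp) (hb : b ∈ S.Γp)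
    (h : a + b = 0) : a = 0 := by
  obtain ⟨D, hD, rfl⟩ := S.exists_multiset ha
  obtain ⟨E, hE, rfl⟩ := S.exists_multiset hb
  have := S.eq_zero_of_sum_eq_zero _ (D + E) rfl
    (fun β hβ => (Multiset.mem_add.mp hβ).elim (hD β) (hE β)) (by rw [Multiset.sum_add, h])
  rw [(add_eq_zero.mp this).1, Multiset.sum_zero]

lemma eq_or_sub_mem {σ α : Module.Dual K S.h} (hσ : σ ∈ S.simples) (hα : α ∈ S.Φp)
    (h : α - σ = 0 ∨ α - σ ∈ S.Φ) : α = σ ∨ α - σ ∈ S.Φp := by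
  rcases h with h | h
  · exact Or.inl (sub_eq_zero.mp h)
  · refine Or.inr ((S.pos_or_neg h).resolve_right fun h1 => hσ.2 ⟨α, hα, _, h1, ?_⟩)
    rw [neg_sub, add_sub_cancel]

/-- A multiset of simple roots whose sum is "large" on the positive root `δ` contains
a simple root equal to `δ` or which can be subtracted from `δ`. -/
lemma exists_eq_or_sub_mem {δ : Module.Dual K S.h} (hδ : δ ∈ S.Φp) {e f : g} {z : S.h}
    (t : S.IsRootTriple δ e f z) {T : Multiset (Module.Dual K S.h)} (hT : ∀ σ ∈ T, σ ∈ S.simples)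
    {m : ℕ} (h : T.sum z = m + 2) : ∃ σ ∈ T, δ = σ ∨ δ - σ ∈ S.Φp := by
  obtain ⟨σ, hσ, h1⟩ := t.symm.exists_mem_add_mem (D := T)
    (fun σ hσ => S.pos_subset (hT σ hσ).1) (by
      rintro ⟨n, hn⟩
      rw [map_neg, h] at hn
      exact neg_ofNat_ne_cast hn)
  refine ⟨σ, hσ, S.eq_or_sub_mem (hT σ hσ) hδ ?_⟩
  rw [← sub_eq_add_neg] at h1
  refine h1.imp (fun h => by rw [← neg_sub, h, neg_zero]) fun h => ?_
  rw [← neg_sub]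
  rcases S.pos_or_neg h with h | h
  · exact S.neg_mem h
  · exact S.pos_subset h

/-- If `σ` can be subtracted from a sum of two positive roots, it can be subtracted from one of
them. -/
lemma sub_mem_or_sub_mem {σ α β : Module.Dual K S.h} (hσ : σ ∈ S.simples) (hα : α ∈ S.Φp)
    (hβ : β ∈ S.Φp) (hαβ : α + β ∈ S.Φp) (h : α + β - σ ∈ S.Φp) :
    (α = σ ∨ α - σ ∈ S.Φp) ∨ (β = σ ∨ β - σ ∈ S.Φp) := by
  obtain ⟨x, hx, hx0⟩ := S.exists_ne_zero (S.pos_subset hα)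
  obtain ⟨y, hy, hy0⟩ := S.exists_ne_zero (S.pos_subset hβ)
  obtain ⟨s, hs, hs0⟩ := S.exists_ne_zero (S.neg_mem hσ.1)
  have key : ∀ γ ∈ S.Φp, ∀ w ∈ rootSp K g S.h γ, ⁅s, w⁆ ≠ 0 → γ = σ ∨ γ - σ ∈ S.Φp := by
    intro γ hγ w hw h0
    refine S.eq_or_sub_mem hσ hγ (or_iff_not_imp_left.mpr fun h1 => ?_)
    refine (S.root_iff _).mpr ⟨h1, (Submodule.ne_bot_iff _).mpr ⟨_, ?_, h0⟩⟩
    rw [sub_eq_add_neg, add_comm]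
    exact lie_mem_rootSp hs hw
  have h1 : ⁅x, y⁆ ≠ 0 :=
    S.lie_ne_zero (S.pos_subset hα) (S.pos_subset hβ) (S.pos_subset hαβ) hx hy hx0 hy0
  have h2 : ⁅s, ⁅x, y⁆⁆ ≠ 0 := by
    refine S.lie_ne_zero (S.neg_mem hσ.1) (S.pos_subset hαβ) ?_ hs (lie_mem_rootSp hx hy) hs0 h1
    rw [neg_add_eq_sub]
    exact S.pos_subset h
  by_cases hsx : ⁅s, x⁆ = 0
  · refine Or.inr (key β hβ y hy fun hsy => h2 ?_)
    rw [leibniz_lie, hsx, hsy, zero_lie, lie_zero, add_zero]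
  · exact Or.inl (key α hα x hx hsx)

/-- A decomposition of a root which is a sum of simple roots is induced by a splitting of that
sum. -/
lemma exists_le_of_add_eq_sum (n : ℕ) : ∀ T : Multiset (Module.Dual K S.h), T.card = n →
    (∀ σ ∈ T, σ ∈ S.simples) → ∀ α ∈ S.Φp, ∀ β ∈ S.Φp, α + β ∈ S.Φp → α + β = T.sum →
      ∃ A B, A + B = T ∧ A.sum = α ∧ B.sum = β := by
  induction n with
  | zero =>
    intro T hn _ α _ β _ hαβ h
    rw [Multiset.card_eq_zero.mp hn, Multiset.sum_zero] at h
    exact absurd h (S.ne_zero_of_pos hαβ)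
  | succ n ih =>
    intro T hn hT α hα β hβ hαβ h
    obtain ⟨e, f, z, t⟩ := S.exists_isRootTriple (S.pos_subset hαβ)
    obtain ⟨σ, hσ, h1⟩ := S.exists_eq_or_sub_mem hαβ t hT (m := 0)
      (by rw [← h, t.apply_eq, Nat.cast_zero, zero_add])
    obtain ⟨T, rfl⟩ := Multiset.exists_cons_of_mem hσ
    have hσs := hT σ hσ
    have hT' : ∀ τ ∈ T, τ ∈ S.simples := fun τ hτ => hT τ (Multiset.mem_cons_of_mem hτ)
    replace h1 := h1.resolve_left fun h1 => hσs.2 ⟨α, hα, β, hβ, h1⟩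
    have hsum : α + β - σ = T.sum := by rw [h, Multiset.sum_cons, add_sub_cancel_left]
    rw [Multiset.card_cons, Nat.add_right_cancel_iff] at hn
    rcases S.sub_mem_or_sub_mem hσs hα hβ hαβ h1 with (h2 | h2) | (h2 | h2)
    · exact ⟨{σ}, T, Multiset.singleton_add _ _, by rw [Multiset.sum_singleton, h2],
        by rw [← hsum, h2, add_sub_cancel_left]⟩
    · obtain ⟨A, B, rfl, hA, hB⟩ := ih T hn hT' (α - σ) h2 β hβ (by rwa [sub_add_eq_add_sub])
        (by rwa [sub_add_eq_add_sub])
      exact ⟨σ ::ₘ A, B, Multiset.cons_add _ _ _, by rw [Multiset.sum_cons, hA, add_sub_cancel],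
        hB⟩
    · exact ⟨T, {σ}, by rw [add_comm, Multiset.singleton_add],
        by rw [← hsum, h2, add_sub_cancel_right], by rw [Multiset.sum_singleton, h2]⟩
    · obtain ⟨A, B, rfl, hA, hB⟩ := ih T hn hT' α hα (β - σ) h2 (by rwa [← add_sub_assoc])
        (by rwa [← add_sub_assoc])
      exact ⟨A, σ ::ₘ B, Multiset.add_cons _ _ _, hA,
        by rw [Multiset.sum_cons, hB, add_sub_cancel]⟩

/-- Every member of a family of positive roots with the same sum as a family of simple roots is
a subsum of the latter. -/
lemma exists_le_sum_eq (n : ℕ) : ∀ D T : Multiset (Module.Dual K S.h), D.card + T.card = n →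
    (∀ β ∈ D, β ∈ S.Φp) → (∀ σ ∈ T, σ ∈ S.simples) → D.sum = T.sum →
      ∀ δ ∈ D, ∃ A ≤ T, A.sum = δ := by
  induction n with
  | zero =>
    intro D T hn _ _ _ δ hδ
    rw [Multiset.card_eq_zero.mp (Nat.add_eq_zero_iff.mp hn).1] at hδ
    exact absurd hδ (Multiset.notMem_zero _)
  | succ n ih =>
    intro D T hn hD hT h δ hδ
    obtain ⟨D, rfl⟩ := Multiset.exists_cons_of_mem hδ
    have hδp := hD δ hδ
    have hD' : ∀ β ∈ D, β ∈ S.Φp := fun β hβ => hD β (Multiset.mem_cons_of_mem hβ)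
    rw [Multiset.card_cons] at hn
    obtain ⟨e, f, z, t⟩ := S.exists_isRootTriple (S.pos_subset hδp)
    by_cases hm : ∃ m : ℕ, D.sum z = m
    · obtain ⟨m, hm⟩ := hm
      obtain ⟨σ, hσ, h1⟩ := S.exists_eq_or_sub_mem hδp t hT (m := m)
        (by rw [← h, Multiset.sum_cons, LinearMap.add_apply, t.apply_eq, hm, add_comm])
      rcases h1 with rfl | h1
      · exact ⟨{δ}, Multiset.singleton_le.mpr hσ, Multiset.sum_singleton _⟩
      · obtain ⟨T, rfl⟩ := Multiset.exists_cons_of_mem hσ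
        rw [Multiset.card_cons] at hn
        obtain ⟨A, hA, hA'⟩ := ih ((δ - σ) ::ₘ D) T (by rw [Multiset.card_cons]; omega)
          (Multiset.forall_mem_cons.mpr ⟨h1, hD'⟩)
          (fun τ hτ => hT τ (Multiset.mem_cons_of_mem hτ))
          (by
            rw [Multiset.sum_cons, Multiset.sum_cons] at h
            rw [Multiset.sum_cons, sub_add_eq_add_sub, h, add_sub_cancel_left])
          (δ - σ) (Multiset.mem_cons_self _ _)
        exact ⟨σ ::ₘ A, (Multiset.cons_le_cons_iff σ).mpr hA,
          by rw [Multiset.sum_cons, hA', add_sub_cancel]⟩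
    · obtain ⟨β, hβ, h1⟩ := t.exists_mem_add_mem (fun β hβ => S.pos_subset (hD' β hβ)) hm
      replace h1 : β + δ ∈ S.Φp := by
        rcases h1 with h1 | h1
        · refine absurd (hD' β hβ) ?_
          rw [eq_neg_of_add_eq_zero_left h1]
          exact S.neg_not_mem hδp
        · exact S.pos_add β (hD' β hβ) δ hδp h1
      obtain ⟨D, rfl⟩ := Multiset.exists_cons_of_mem hβ
      rw [Multiset.card_cons] at hn
      obtain ⟨A, hA, hA'⟩ := ih ((β + δ) ::ₘ D) T (by rw [Multiset.card_cons]; omega)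
        (Multiset.forall_mem_cons.mpr
          ⟨h1, fun γ hγ => hD' γ (Multiset.mem_cons_of_mem hγ)⟩) hT
        (by
          rw [← h, Multiset.sum_cons, Multiset.sum_cons, Multiset.sum_cons]
          abel)
        (β + δ) (Multiset.mem_cons_self _ _)
      obtain ⟨B, C, rfl, -, hC⟩ := S.exists_le_of_add_eq_sum _ A rfl
        (fun σ hσ => hT σ (Multiset.mem_of_le hA hσ)) β (hD' β hβ) δ hδp h1 hA'.symm
      exact ⟨C, (Multiset.le_add_left _ _).trans hA, hC⟩

lemma exists_le_sum_eq_sum {E : Multiset (Module.Dual K S.h)} (hE : ∀ β ∈ E, β ∈ S.Φp)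
    (D : Multiset (Module.Dual K S.h)) : ∀ T : Multiset (Module.Dual K S.h),
    (∀ β ∈ D, β ∈ S.Φp) → (∀ σ ∈ T, σ ∈ S.simples) → (D + E).sum = T.sum →
      ∃ A ≤ T, A.sum = D.sum := by
  induction D using Multiset.induction_on with
  | empty => exact fun T _ _ _ => ⟨0, Multiset.zero_le _, rfl⟩
  | cons δ D ih =>
    intro T hD hT h
    rw [Multiset.forall_mem_cons] at hD
    rw [Multiset.cons_add] at h
    obtain ⟨A, hA, hA'⟩ := S.exists_le_sum_eq _ (δ ::ₘ (D + E)) T rfl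
      (Multiset.forall_mem_cons.mpr
        ⟨hD.1, fun β hβ => (Multiset.mem_add.mp hβ).elim (hD.2 β) (hE β)⟩) hT h δ
      (Multiset.mem_cons_self _ _)
    obtain ⟨T, rfl⟩ := Multiset.le_iff_exists_add.mp hA
    rw [Multiset.sum_cons, Multiset.sum_add A, hA'] at h
    obtain ⟨B, hB, hB'⟩ := ih T hD.2 (fun σ hσ => hT σ (Multiset.mem_add.mpr (Or.inr hσ)))
      (add_left_cancel h)
    exact ⟨A + B, add_le_add_right hB A, by rw [Multiset.sum_add, Multiset.sum_cons, hA', hB']⟩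

lemma not_remote_of_mem_closure_simples {μ lam : Module.Dual K S.h}
    (h : lam - μ ∈ AddSubmonoid.closure S.simples) : ¬ S.Remote μ lam := by
  classical
  obtain ⟨T, hT, hTs⟩ := S.exists_multiset h
  refine Set.not_infinite.mpr (Set.Finite.subset
    ((Set.finite_Iic T).image fun A => A.sum + μ) ?_)
  rintro ν ⟨h1, h2⟩
  obtain ⟨D, hD, hDs⟩ := S.exists_multiset h1
  obtain ⟨E, hE, hEs⟩ := S.exists_multiset h2
  obtain ⟨A, hA, hAs⟩ := S.exists_le_sum_eq_sum hE D T hD hT (by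
    rw [Multiset.sum_add, hDs, hEs, hTs]
    abel)
  exact ⟨A, hA, by
    show A.sum + μ = ν
    rw [hAs, hDs, sub_add_cancel]⟩

end RootReductive

namespace RootReductive

variable (S : RootReductive K g)

attribute [local instance] LieRing.ofAssociativeRing

/-- Induction along decompositions of positive roots in a finite set. -/
lemma decomposition_induction {A : Set (Module.Dual K S.h)} (hfin : A.Finite) (hA : A ⊆ S.Φp)
    (hdec : ∀ β ∈ S.Φp, ∀ γ ∈ S.Φp, β + γ ∈ A → β ∈ A ∧ γ ∈ A)
    {P : Module.Dual K S.h → Prop} (h₀ : ∀ α ∈ S.simples, P α)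
    (h₁ : ∀ β ∈ S.Φp, ∀ γ ∈ S.Φp, β + γ ∈ S.Φp → P β → P γ → P (β + γ)) :
    ∀ α ∈ A, P α := by
  let r : Module.Dual K S.h → Module.Dual K S.h → Prop := fun β α => α - β ∈ S.Γp ∧ α - β ≠ 0
  have hr : ∀ β ∈ S.Φp, ∀ γ ∈ S.Φp, r β (β + γ) ∧ r γ (β + γ) := fun β hβ γ hγ => by
    refine ⟨⟨?_, ?_⟩, ⟨?_, ?_⟩⟩
    · rw [add_sub_cancel_left]; exact AddSubmonoid.subset_closure hγ
    · rw [add_sub_cancel_left]; exact S.ne_zero_of_pos hγ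
    · rw [add_sub_cancel_right]; exact AddSubmonoid.subset_closure hβ
    · rw [add_sub_cancel_right]; exact S.ne_zero_of_pos hβ
  have hwf : A.WellFoundedOn r := by
    have : IsStrictOrder (Module.Dual K S.h) r :=
      { irrefl := fun a ha => ha.2 (sub_self a)
        trans := fun a b c hab hbc => by
          have h1 : c - a = (c - b) + (b - a) := (sub_add_sub_cancel c b a).symm
          refine ⟨h1 ▸ add_mem hbc.1 hab.1, fun h => hbc.2 ?_⟩
          exact S.eq_zero_of_add_eq_zero hbc.1 hab.1 (h1 ▸ h) }
    exact hfin.wellFoundedOn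
  intro α hα
  refine hwf.induction hα (P := P) fun α hα ih => ?_
  by_cases hs : α ∈ S.simples
  · exact h₀ α hs
  · have : ∃ β ∈ S.Φp, ∃ γ ∈ S.Φp, β + γ = α := by
      by_contra hc
      exact hs ⟨hA hα, hc⟩
    obtain ⟨β, hβ, γ, hγ, rfl⟩ := this
    obtain ⟨h2, h3⟩ := hdec β hβ γ hγ hα
    exact h₁ β hβ γ hγ (hA hα) (ih β h2 (hr β hβ γ hγ).1) (ih γ h3 (hr β hβ γ hγ).2)

/-- The total of a multiset of positive roots. -/
def total : (S.Φp →₀ ℕ) →ₗ[ℕ] Module.Dual K S.h := Finsupp.linearCombination ℕ Subtype.val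

lemma total_mem {B : AddSubmonoid (Module.Dual K S.h)} {m : S.Φp →₀ ℕ}
    (h : ∀ α ∈ m.support, α.1 ∈ B) : S.total m ∈ B := by
  rw [total, Finsupp.linearCombination_apply]
  exact AddSubmonoid.sum_mem _ fun α hα => AddSubmonoid.nsmul_mem _ (h α hα) _

lemma total_mem_Γp (m : S.Φp →₀ ℕ) : S.total m ∈ S.Γp :=
  S.total_mem fun α _ => AddSubmonoid.subset_closure α.2

lemma total_sub_mem {m : S.Φp →₀ ℕ} {α : S.Φp} (hα : α ∈ m.support) : S.total m - α.1 ∈ S.Γp := by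
  have h : m = Finsupp.single α 1 + (m - Finsupp.single α 1) := by
    rw [add_tsub_cancel_of_le]
    rw [Finsupp.single_le_iff]
    exact Nat.one_le_iff_ne_zero.mpr (Finsupp.mem_support_iff.mp hα)
  rw [h, map_add]
  have : S.total (Finsupp.single α 1) = α.1 := by simp [total]
  rw [this, add_sub_cancel_left]
  exact S.total_mem_Γp _

lemma act_h_monomial (lam : Module.Dual K S.h) (H : S.h) (m : S.Φp →₀ ℕ) :
    (S.datum lam).act H (MvPolynomial.monomial m 1) =
      (lam - S.total m) H • MvPolynomial.monomial m 1 := by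
  induction m using InductionDatum.monomial_induction with
  | h₀ =>
    have h1 : (S.datum lam).lin (H : g) = 0 :=
      (S.datum lam).lin_eq_zero ((S.negPart_eq_zero_iff H).mpr (S.h_le_b H.2))
    have h2 : (S.datum lam).χ H = lam H := S.extend_h lam H
    have := (S.datum lam).act_one (H : g)
    rw [h1, h2, zero_add] at this
    simpa using this
  | h₁ i m hi ih =>
    have h1 : ⁅(H : g), S.negVec i⁆ = -(i.1 H) • S.negVec i := S.negVec_mem i H
    have h2 : (S.datum lam).act (S.negVec i) (MvPolynomial.monomial m 1) =
      MvPolynomial.monomial (Finsupp.single i 1 + m) 1 := by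
      rw [← InductionDatum.X_mul_monomial]
      exact (S.datum lam).act_f_monomial hi
    have h3 := (S.datum lam).act_lie (H : g) (S.negVec i) (MvPolynomial.monomial m 1)
    rw [h1, map_smul, LinearMap.smul_apply, ih m le_rfl, map_smul, h2, eq_sub_iff_add_eq,
      ← add_smul] at h3
    rw [← h3, map_add]
    congr 1
    simp [total]
    ring

lemma coeff_act_h (lam : Module.Dual K S.h) (H : S.h) (p : MvPolynomial S.Φp K)
    (m : S.Φp →₀ ℕ) : ((S.datum lam).act H p).coeff m = (lam - S.total m) H * p.coeff m := by
  induction p using MvPolynomial.induction_on' with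
  | monomial u a =>
    have : MvPolynomial.monomial u a = a • (MvPolynomial.monomial u (1 : K)) := by
      simp [MvPolynomial.smul_monomial]
    rw [this, map_smul, S.act_h_monomial, MvPolynomial.coeff_smul, MvPolynomial.coeff_smul,
      MvPolynomial.coeff_smul, MvPolynomial.coeff_monomial]
    split_ifs with h
    · rw [h]; simp; ring
    · simp
  | add p q hp hq => rw [map_add, MvPolynomial.coeff_add, hp, hq, MvPolynomial.coeff_add, mul_add]

lemma weight_of_coeff_ne_zero {lam ν : Module.Dual K S.h} {p : MvPolynomial S.Φp K}
    (hp : ∀ H : S.h, (S.datum lam).act H p = ν H • p) {m : S.Φp →₀ ℕ} (hm : p.coeff m ≠ 0) :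
    lam - ν = S.total m := by
  rw [sub_eq_iff_eq_add, ← sub_eq_iff_eq_add']
  ext H
  have := S.coeff_act_h lam H p m
  rw [hp H, MvPolynomial.coeff_smul, smul_eq_mul] at this
  exact (mul_right_cancel₀ hm this).symm

lemma singular_h {lam μ : Module.Dual K S.h} {p : MvPolynomial S.Φp K}
    (hp : p ∈ (S.datum lam).singular (S.extend μ)) (H : S.h) :
    (S.datum lam).act H p = μ H • p := by
  rw [← S.extend_h μ H]
  exact hp H ((S.negPart_eq_zero_iff H).mpr (S.h_le_b H.2))

lemma singular_of_pos {lam μ : Module.Dual K S.h} {p : MvPolynomial S.Φp K}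
    (hp : p ∈ (S.datum lam).singular (S.extend μ)) {β : Module.Dual K S.h} (hβ : β ∈ S.Φp)
    {x : g} (hx : x ∈ rootSp K g S.h β) : (S.datum lam).act x p = 0 := by
  have h1 : S.negPart x = 0 := (S.negPart_eq_zero_iff x).mpr (S.mem_b_of_root (Or.inr hβ) hx)
  rw [hp x h1, S.extend_of_ne μ (S.ne_zero_of_pos hβ) hx, zero_smul]

/-- The subalgebra `l_b` contains the root spaces of `±α` for all `α` obtained from simple
roots by decompositions within a finite set. -/
lemma rootSp_le_bFinitePart {A : Set (Module.Dual K S.h)} (hfin : A.Finite) (hA : A ⊆ S.Φp)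
    (hdec : ∀ β ∈ S.Φp, ∀ γ ∈ S.Φp, β + γ ∈ A → β ∈ A ∧ γ ∈ A) :
    ∀ α ∈ A, rootSp K g S.h α ≤ (bFinitePart S).toSubmodule ∧
      rootSp K g S.h (-α) ≤ (bFinitePart S).toSubmodule := by
  have key : ∀ β ∈ S.Φ, ∀ γ ∈ S.Φ, β + γ ∈ S.Φ →
      rootSp K g S.h β ≤ (bFinitePart S).toSubmodule →
      rootSp K g S.h γ ≤ (bFinitePart S).toSubmodule →
      rootSp K g S.h (β + γ) ≤ (bFinitePart S).toSubmodule := by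
    intro β hβ γ hγ hβγ h1 h2 z hz
    obtain ⟨x, hx, hx0⟩ := S.exists_ne_zero hβ
    obtain ⟨y, hy, hy0⟩ := S.exists_ne_zero hγ
    obtain ⟨c, rfl⟩ := S.rootSp_eq_span hβγ (lie_mem_rootSp hx hy)
      (S.lie_ne_zero hβ hγ hβγ hx hy hx0 hy0) hz
    exact Submodule.smul_mem _ _ ((bFinitePart S).lie_mem (h1 hx) (h2 hy))
  refine S.decomposition_induction hfin hA hdec (fun α hα => ⟨fun x hx => ?_, fun x hx => ?_⟩)
    fun β hβ γ hγ hβγ h1 h2 => ⟨?_, ?_⟩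
  · exact LieSubalgebra.subset_lieSpan (Or.inr (Set.mem_biUnion hα (Or.inl hx)))
  · exact LieSubalgebra.subset_lieSpan (Or.inr (Set.mem_biUnion hα (Or.inr hx)))
  · exact key β (S.pos_subset hβ) γ (S.pos_subset hγ) (S.pos_subset hβγ) h1.1 h2.1
  · have := key (-β) (S.neg_mem hβ) (-γ) (S.neg_mem hγ)
    rw [← neg_add] at this
    exact this (S.neg_mem hβγ) h1.2 h2.2

lemma rootSp_le_of_not_remote {μ lam : Module.Dual K S.h} (hr : ¬ S.Remote μ lam)
    {α : Module.Dual K S.h} (hα : α ∈ S.Φp) (h : lam - μ - α ∈ S.Γp) :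
    rootSp K g S.h α ≤ (bFinitePart S).toSubmodule ∧
      rootSp K g S.h (-α) ≤ (bFinitePart S).toSubmodule := by
  refine S.rootSp_le_bFinitePart (A := {α ∈ S.Φp | lam - μ - α ∈ S.Γp}) ?_ (fun α h => h.1) ?_
    α ⟨hα, h⟩
  · rw [Remote, Set.not_infinite] at hr
    refine Set.Finite.of_finite_image (f := (μ + ·)) (hr.subset ?_)
      (add_right_injective μ).injOn
    rintro _ ⟨α, hα, rfl⟩
    constructor
    · show μ + α - μ ∈ S.Γp
      rw [add_sub_cancel_left]
      exact AddSubmonoid.subset_closure hα.1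
    · show lam - (μ + α) ∈ S.Γp
      rw [← sub_sub]
      exact hα.2
  · rintro β hβ γ hγ ⟨-, h⟩
    refine ⟨⟨hβ, ?_⟩, ⟨hγ, ?_⟩⟩
    · have : lam - μ - β = (lam - μ - (β + γ)) + γ := by abel
      rw [this]
      exact add_mem h (AddSubmonoid.subset_closure hγ)
    · have : lam - μ - γ = (lam - μ - (β + γ)) + β := by abel
      rw [this]
      exact add_mem h (AddSubmonoid.subset_closure hβ)

end RootReductive

namespace InductionDatum

open MvPolynomial

variable {L I : Type} [LieRing L] [LieAlgebra K L] (D : InductionDatum K L I)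

lemma pderiv_lin (i : I) (x : L) : pderiv i (D.lin x) = C (D.π x i) := by
  classical
  rw [lin, LinearMap.comp_apply, Finsupp.linearCombination_apply, Finsupp.sum, map_sum]
  rw [Finset.sum_eq_single i]
  · rw [Derivation.map_smul, pderiv_X_self, smul_eq_C_mul, mul_one]
  · intro j _ hj
    rw [Derivation.map_smul, pderiv_X_of_ne hj, smul_zero]
  · intro h
    rw [Finsupp.notMem_support_iff.mp h, zero_smul, map_zero]

lemma pderiv_ne_zero {i : I} {p : MvPolynomial I K} (hi : i ∈ p.vars) : pderiv i p ≠ 0 := by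
  classical
  obtain ⟨m, hm, him⟩ := (mem_vars_iff_mem_support i).mp hi
  intro h
  have h1 : m - Finsupp.single i 1 + Finsupp.single i 1 = m := by
    rw [tsub_add_cancel_of_le]
    rw [Finsupp.single_le_iff]
    exact Nat.one_le_iff_ne_zero.mpr (Finsupp.mem_support_iff.mp him)
  have := congrArg (coeff (m - Finsupp.single i 1)) h
  rw [coeff_pderiv, h1, coeff_zero] at this
  rcases mul_eq_zero.mp this with h | h
  · exact mem_support_iff.mp hm h
  · exact Nat.cast_add_one_ne_zero _ h

variable [LinearOrder I]

lemma pderiv_symb (i j : I) (x : L) (c : K) (hj : D.π ⁅x, D.f j⁆ i = c)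
    (hx : ∀ k ≠ j, D.π ⁅x, D.f k⁆ i = 0) (p : MvPolynomial I K) :
    pderiv i (D.symb x p) - D.symb x (pderiv i p) = c • pderiv j p := by
  have : ⁅pderiv (R := K) i, D.symb x⁆ = c • pderiv (R := K) j := by
    refine MvPolynomial.derivation_ext (R := K) fun k => ?_
    have h1 : D.symb x (pderiv i (X k)) = 0 := by
      classical
      rw [pderiv_X, Pi.single_apply]
      split_ifs <;> simp
    rw [Derivation.commutator_apply, h1, symb, mkDerivation_X, pderiv_lin, sub_zero,
      Derivation.smul_apply]
    by_cases hk : k = j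
    · rw [hk, hj, pderiv_X_self, smul_eq_C_mul, mul_one]
    · rw [hx k hk, pderiv_X_of_ne hk, smul_zero, map_zero]
  rw [← Derivation.commutator_apply, this, Derivation.smul_apply]

end InductionDatum

namespace RootReductive

variable (S : RootReductive K g)

lemma mem_vars_of_add {lam : Module.Dual K S.h} {q : MvPolynomial S.Φp K}
    (hq : ∀ β ∈ S.Φp, ∀ x ∈ rootSp K g S.h β, (S.datum lam).symb x q = 0)
    {α β γ : S.Φp} (h : β.1 + γ.1 = α.1) (hα : α ∈ q.vars) : γ ∈ q.vars := by
  by_contra hγ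
  obtain ⟨x, hx, hx0⟩ := S.exists_ne_zero (S.pos_subset β.2)
  have hw : β.1 + -α.1 = -γ.1 := by rw [← h]; abel
  have hmem : ⁅x, S.negVec α⁆ ∈ rootSp K g S.h (-γ.1) := by
    rw [← hw]
    exact lie_mem_rootSp hx (S.negVec_mem α)
  have hne : ⁅x, S.negVec α⁆ ≠ 0 :=
    S.lie_ne_zero (S.pos_subset β.2) (S.neg_mem α.2) (by rw [hw]; exact S.neg_mem γ.2) hx
      (S.negVec_mem α) hx0 (S.negVec_ne_zero α)
  obtain ⟨c, hc, hcx⟩ := S.negPart_of_neg γ hmem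
  have hc0 : c ≠ 0 := by
    rintro rfl
    exact hne (by rw [← hcx, zero_smul])
  have h1 : (S.datum lam).π ⁅x, (S.datum lam).f α⁆ γ = c := by
    show S.negPart ⁅x, S.negVec α⁆ γ = c
    rw [hc, Finsupp.single_eq_same]
  have h2 : ∀ δ ≠ α, (S.datum lam).π ⁅x, (S.datum lam).f δ⁆ γ = 0 := by
    intro δ hδ
    show S.negPart ⁅x, S.negVec δ⁆ γ = 0
    have hm := lie_mem_rootSp hx (S.negVec_mem δ)
    by_cases h3 : -(β.1 + -δ.1) ∈ S.Φp
    · obtain ⟨d, hd, -⟩ := S.negPart_of_neg ⟨_, h3⟩ (x := ⁅x, S.negVec δ⁆) (by rwa [neg_neg])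
      rw [hd]
      refine Finsupp.single_eq_of_ne' fun h4 => hδ (Subtype.ext ?_)
      have h5 := congrArg Subtype.val h4
      simp only at h5
      rw [← h, ← h5]
      abel
    · rw [S.negPart_of_not_neg h3 hm]
      rfl
  have h3 := (S.datum lam).pderiv_symb γ α x c h1 h2 q
  rw [hq β.1 β.2 x hx, map_zero, MvPolynomial.pderiv_eq_zero_of_notMem_vars hγ, map_zero, sub_zero,
    eq_comm, smul_eq_zero] at h3
  exact InductionDatum.pderiv_ne_zero hα (h3.resolve_left hc0)

lemma singular_eq_bot {μ lam : Module.Dual K S.h} (hr : S.Remote μ lam) :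
    (S.datum lam).singular (S.extend μ) = ⊥ := by
  rw [eq_bot_iff]
  intro p hp
  by_contra hp0
  refine S.not_remote_of_mem_closure_simples ?_ hr
  let q := MvPolynomial.homogeneousComponent p.totalDegree p
  have hq0 : q ≠ 0 := by
    obtain ⟨m, hm, hd⟩ := Finset.exists_mem_eq_sup p.support
      (MvPolynomial.support_nonempty.mpr hp0) fun s => s.sum fun _ e => e
    refine MvPolynomial.ne_zero_iff.mpr ⟨m, ?_⟩
    rw [MvPolynomial.coeff_homogeneousComponent, if_pos]
    · exact MvPolynomial.mem_support_iff.mp hm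
    · exact hd.symm
  obtain ⟨m, hm⟩ := MvPolynomial.ne_zero_iff.mp hq0
  have hmp : p.coeff m ≠ 0 := by
    intro h
    apply hm
    rw [MvPolynomial.coeff_homogeneousComponent, h, ite_self]
  have hq : ∀ β ∈ S.Φp, ∀ x ∈ rootSp K g S.h β, (S.datum lam).symb x q = 0 := fun β hβ x hx =>
    (S.datum lam).symb_leading_eq_zero
      ((S.negPart_eq_zero_iff x).mpr (S.mem_b_of_root (Or.inr hβ) hx))
      (S.extend_of_ne lam (S.ne_zero_of_pos hβ) hx) (S.singular_of_pos hp hβ hx)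
  rw [S.weight_of_coeff_ne_zero (S.singular_h hp) hmp]
  have hA := S.decomposition_induction (A := Subtype.val '' (q.vars : Set S.Φp))
    (q.vars.finite_toSet.image _) (by rintro _ ⟨α, -, rfl⟩; exact α.2)
    (by
      rintro β hβ γ hγ ⟨α, hα, h⟩
      exact ⟨⟨⟨β, hβ⟩, S.mem_vars_of_add hq (β := ⟨γ, hγ⟩) (by rw [h, add_comm]) hα, rfl⟩,
        ⟨⟨γ, hγ⟩, S.mem_vars_of_add hq (β := ⟨β, hβ⟩) h.symm hα, rfl⟩⟩)
    (P := (· ∈ AddSubmonoid.closure S.simples))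
    (fun α hα => AddSubmonoid.subset_closure hα) (fun β _ γ _ _ => add_mem)
  refine S.total_mem fun α hα => hA α ⟨α, ?_, rfl⟩
  exact (MvPolynomial.mem_vars_iff_mem_support α).mpr ⟨m, MvPolynomial.mem_support_iff.mpr hm, hα⟩

/-- Extension of the coefficients from a subalgebra to `g`. -/
abbrev incl : MvPolynomial (S.negIn (bFinitePart S)) K →ₐ[K] MvPolynomial S.Φp K :=
  MvPolynomial.rename (OrderEmbedding.subtype (· ∈ S.negIn (bFinitePart S)))

lemma act_incl (lam : Module.Dual K S.h) (x : bFinitePart S)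
    (p : MvPolynomial (S.negIn (bFinitePart S)) K) :
    (S.datum lam).act (x : g) (S.incl p) =
      S.incl ((S.subDatum _ (h_le_bFinitePart S) lam).act x p) :=
  (S.compatible _ (h_le_bFinitePart S) lam).act_rename x p

lemma incl_injective : Function.Injective S.incl :=
  MvPolynomial.rename_injective _ (OrderEmbedding.subtype _).injective

lemma mem_singular_incl {μ lam : Module.Dual K S.h} (hr : ¬ S.Remote μ lam)
    (p : MvPolynomial (S.negIn (bFinitePart S)) K) :
    S.incl p ∈ (S.datum lam).singular (S.extend μ) ↔
      p ∈ (S.subDatum _ (h_le_bFinitePart S) lam).singular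
        (S.subDatum _ (h_le_bFinitePart S) μ).χ := by
  constructor
  · intro h x hx
    apply S.incl_injective
    rw [← S.act_incl, map_smul]
    exact h x ((S.subNegPart_eq_zero_iff _ (h_le_bFinitePart S) x).mp hx)
  · intro h
    have hsub : ∀ x (hx : x ∈ bFinitePart S), S.negPart x = 0 →
        (S.datum lam).act x (S.incl p) = S.extend μ x • S.incl p := fun x hx h0 => by
      rw [S.act_incl lam ⟨x, hx⟩, h ⟨x, hx⟩
        ((S.subNegPart_eq_zero_iff _ (h_le_bFinitePart S) _).mpr h0), map_smul]
      rfl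
    have hH : ∀ H : S.h, (S.datum lam).act H (S.incl p) = μ H • S.incl p := fun H => by
      rw [hsub H (h_le_bFinitePart S H.2) ((S.negPart_eq_zero_iff _).mpr (S.h_le_b H.2)),
        S.extend_h]
    intro x hx
    rw [← sub_eq_zero]
    refine S.b_induction (LinearMap.ker ((S.datum lam).act.flip (S.incl p) -
      (S.extend μ).smulRight (S.incl p))) (fun χ hχ x hx => ?_) ((S.negPart_eq_zero_iff x).mp hx)
    show (S.datum lam).act x (S.incl p) - S.extend μ x • S.incl p = 0
    rw [sub_eq_zero]
    have hneg : S.negPart x = 0 := (S.negPart_eq_zero_iff x).mpr (S.mem_b_of_root hχ hx)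
    rcases hχ with rfl | hχ
    · exact hsub x (h_le_bFinitePart S (S.rootSp_zero_le hx)) hneg
    · by_cases hv : (S.datum lam).act x (S.incl p) = 0
      · rw [hv, S.extend_of_ne μ (S.ne_zero_of_pos hχ) hx, zero_smul]
      · obtain ⟨m, hm⟩ := MvPolynomial.ne_zero_iff.mp hv
        have hwt : ∀ H : S.h, (S.datum lam).act H ((S.datum lam).act x (S.incl p)) =
            (μ + χ) H • (S.datum lam).act x (S.incl p) := by
          intro H
          have := (S.datum lam).act_lie (H : g) x (S.incl p)
          rw [hx H, map_smul, LinearMap.smul_apply, hH H, map_smul, eq_sub_iff_add_eq,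
            ← add_smul] at this
          rw [← this, add_comm]
          rfl
        have h1 := S.weight_of_coeff_ne_zero hwt hm
        have h2 : lam - μ - χ ∈ S.Γp := by
          rw [sub_sub, h1]
          exact S.total_mem_Γp m
        exact hsub x ((S.rootSp_le_of_not_remote hr hχ h2).1 hx) hneg

lemma exists_incl_eq {μ lam : Module.Dual K S.h} (hr : ¬ S.Remote μ lam)
    {p : MvPolynomial S.Φp K} (hp : p ∈ (S.datum lam).singular (S.extend μ)) :
    ∃ q, S.incl q = p := by
  refine MvPolynomial.exists_rename_eq_of_vars_subset_range p _ (OrderEmbedding.subtype _).injective ?_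
  intro α hα
  obtain ⟨m, hm, hαm⟩ := (MvPolynomial.mem_vars_iff_mem_support α).mp hα
  refine ⟨⟨α, (S.rootSp_le_of_not_remote hr α.2 ?_).2⟩, rfl⟩
  rw [S.weight_of_coeff_ne_zero (S.singular_h hp) (MvPolynomial.mem_support_iff.mp hm)]
  exact S.total_sub_mem hαm

lemma nonempty_singular_equiv_sub {μ lam : Module.Dual K S.h} (hr : ¬ S.Remote μ lam) :
    Nonempty ((S.subDatum _ (h_le_bFinitePart S) lam).singular
        (S.subDatum _ (h_le_bFinitePart S) μ).χ ≃ₗ[K]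
      (S.datum lam).singular (S.datum μ).χ) := by
  let T : (S.subDatum _ (h_le_bFinitePart S) lam).singular
        (S.subDatum _ (h_le_bFinitePart S) μ).χ →ₗ[K]
      (S.datum lam).singular (S.datum μ).χ :=
    (S.incl.toLinearMap).restrict fun p hp => (S.mem_singular_incl hr p).mpr hp
  refine ⟨LinearEquiv.ofBijective T ⟨fun p q h => ?_, fun p => ?_⟩⟩
  · exact Subtype.ext (S.incl_injective (congrArg Subtype.val h))
  · obtain ⟨q, hq⟩ := S.exists_incl_eq hr p.2
    exact ⟨⟨q, (S.mem_singular_incl hr q).mp (hq ▸ p.2)⟩, Subtype.ext hq⟩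

end RootReductive

/-- homomorphisms between Verma modules for an arbitrary splitting Borel
subalgebra: (i) if `λ` and `μ` are not remote then `Hom_g(Δ(μ), Δ(λ)) ≅
Hom_{l_b}(Δ_{l_b}(μ), Δ_{l_b}(λ))`; (ii) if they are remote then the Hom-space is 0. -/
theorem hom_verma_nonDynkin (S : RootReductive K g) (μ lam : Module.Dual K S.h) :
    -- (i)
    (¬ S.Remote μ lam →
      (let _i1 := homKModule K g (S.Verma μ) (S.Verma lam)
       let _i2 := homKModule K (bFinitePart S)
         (S.VermaSub (bFinitePart S) (h_le_bFinitePart S) μ)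
         (S.VermaSub (bFinitePart S) (h_le_bFinitePart S) lam)
       Nonempty (((S.Verma μ) →ₗ[UEA K g] (S.Verma lam)) ≃ₗ[K]
         ((S.VermaSub (bFinitePart S) (h_le_bFinitePart S) μ) →ₗ[UEA K (bFinitePart S)]
           (S.VermaSub (bFinitePart S) (h_le_bFinitePart S) lam))))) ∧
    -- (ii)
    (S.Remote μ lam → ∀ f : (S.Verma μ) →ₗ[UEA K g] (S.Verma lam), f = 0) := by
  have e₁ := InductionDatum.nonempty_singular_equiv (S.datum lam) (S.datum μ) (fun _ => Iff.rfl)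
    _ _ (S.vIdeal_eq lam) (S.vIdeal_eq μ)
  refine ⟨fun hr => ?_, fun hr f => ?_⟩
  · have e₂ := InductionDatum.nonempty_singular_equiv (S.subDatum _ (h_le_bFinitePart S) lam)
      (S.subDatum _ (h_le_bFinitePart S) μ) (fun _ => Iff.rfl)
      _ _ (S.vIdealSub_eq _ (h_le_bFinitePart S) lam) (S.vIdealSub_eq _ (h_le_bFinitePart S) μ)
    intro _i1 _i2
    obtain ⟨e₁⟩ := e₁
    obtain ⟨e₂⟩ := e₂
    obtain ⟨e₃⟩ := S.nonempty_singular_equiv_sub hr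
    exact ⟨(e₁.symm.trans e₃.symm).trans e₂⟩
  · obtain ⟨e⟩ := e₁
    have h1 : (S.datum lam).singular (S.datum μ).χ = ⊥ := S.singular_eq_bot hr
    let _ := homKModule K g (S.Verma μ) (S.Verma lam)
    have h2 : e.symm f = 0 := Subtype.ext ((Submodule.mem_bot K).mp (h1 ▸ (e.symm f).2))
    exact e.symm.map_eq_zero_iff.mp h2
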